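/- Assume RH. For every σ ∈ (1/2, 1) and δ > 0, one has ∑_{n=1}^∞ Λ(n) n^{−σ} e^{−δn} ≤ δ^{σ−1}/(1−σ) + 0.07/(2σ−1) + 4. -/

import Mathlib

section

open Complex Set Filter Topology MeasureTheory

/-- The entire function `s (s - 1) Λ(s)`, normalised by its values `1` at `0` and `1`. -/
noncomputable def xiFun (s : ℂ) : ℂ := s * (s - 1) * completedRiemannZeta₀ s + 1

lemma differentiable_xiFun : Differentiable ℂ xiFun := by
  have := differentiable_completedZeta₀
  unfold xiFun
  fun_prop

lemma xiFun_one_sub (s : ℂ) : xiFun (1 - s) = xiFun s := by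
  rw [xiFun, xiFun, completedRiemannZeta₀_one_sub]
  ring

lemma xiFun_one : xiFun 1 = 1 := by simp [xiFun]

lemma two_mul_pi_cpow_mul_Gamma_ne_zero {s : ℂ} (hs : 0 < s.re) :
    2 * (Real.pi : ℂ) ^ (-s / 2) * Gamma (s / 2 + 1) ≠ 0 := by
  have hG : Gamma (s / 2 + 1) ≠ 0 := by
    apply Gamma_ne_zero_of_re_pos
    simp
    positivity
  have hp : (Real.pi : ℂ) ^ (-s / 2) ≠ 0 := by
    simp [cpow_eq_zero_iff, Real.pi_ne_zero]
  exact mul_ne_zero (mul_ne_zero two_ne_zero hp) hG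

lemma xiFun_eq {s : ℂ} (hs : 0 < s.re) (hs1 : s ≠ 1) :
    xiFun s = (s - 1) * riemannZeta s * (2 * (Real.pi : ℂ) ^ (-s / 2) * Gamma (s / 2 + 1)) := by
  rw [riemannZeta_eq_mul_completedRiemannZeta₀, mul_assoc,
    div_mul_cancel₀ _ (two_mul_pi_cpow_mul_Gamma_ne_zero hs), xiFun]
  have : 1 - s ≠ 0 := sub_ne_zero.mpr hs1.symm
  field_simp
  ring

lemma xiFun_conj_of_re_pos {s : ℂ} (hs : 0 < s.re) :
    xiFun (starRingEnd ℂ s) = starRingEnd ℂ (xiFun s) := by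
  by_cases h1 : s = 1
  · simp [h1, xiFun_one]
  · have h1' : starRingEnd ℂ s ≠ 1 := by
      simpa using (map_ne_one_iff _ (starRingEnd ℂ).injective).mpr h1
    rw [xiFun_eq hs h1, xiFun_eq (by simpa using hs) h1', riemannZeta_conj]
    have hp : (Real.pi : ℂ) ^ (-(starRingEnd ℂ s) / 2) =
        starRingEnd ℂ ((Real.pi : ℂ) ^ (-s / 2)) := by
      have harg : arg (Real.pi : ℂ) ≠ Real.pi := by
        rw [arg_ofReal_of_nonneg Real.pi_pos.le]
        exact Real.pi_pos.ne
      simpa [map_ofNat] using cpow_conj (Real.pi : ℂ) (-s / 2) harg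
    have hG : Gamma (starRingEnd ℂ s / 2 + 1) = starRingEnd ℂ (Gamma (s / 2 + 1)) := by
      rw [← Gamma_conj]
      simp [map_ofNat]
    rw [hp, hG]
    simp [map_ofNat]

lemma xiFun_ne_zero (hRH : RiemannHypothesis) {s : ℂ} (hs : 1 / 2 < s.re) : xiFun s ≠ 0 := by
  by_cases h1 : s = 1
  · simp [h1, xiFun_one]
  · have h0 : 0 < s.re := by linarith
    rw [xiFun_eq h0 h1]
    refine mul_ne_zero (mul_ne_zero (sub_ne_zero.mpr h1) fun hz => ?_)
      (two_mul_pi_cpow_mul_Gamma_ne_zero h0)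
    refine hs.ne' (hRH s hz ?_ h1)
    rintro ⟨n, rfl⟩
    simp at h0
    norm_cast at h0

lemma logDeriv_xiFun_one : logDeriv xiFun 1 =
    (((Real.eulerMascheroniConstant - Real.log (4 * Real.pi)) / 2 + 1 : ℝ) : ℂ) := by
  have hd : HasDerivAt xiFun (completedRiemannZeta₀ 1) 1 := by
    have h := ((((hasDerivAt_id (1 : ℂ)).mul ((hasDerivAt_id (1 : ℂ)).sub_const 1)).mul
      (differentiable_completedZeta₀ 1).hasDerivAt).add_const 1)
    rw [show xiFun = fun s => s * (s - 1) * completedRiemannZeta₀ s + 1 from rfl]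
    simpa using h
  rw [logDeriv_apply, hd.deriv, xiFun_one, div_one, completedRiemannZeta₀_one]
  push_cast
  rw [ofReal_log (by positivity)]
  push_cast
  rfl

lemma log_four_mul_pi_ge : 2.527 ≤ Real.log (4 * Real.pi) := by
  have hpi := Real.pi_gt_d4
  rw [Real.le_log_iff_exp_le (by positivity)]
  have h := Real.exp_one_lt_d9
  have h2 : Real.exp 2.527 = Real.exp 1 ^ 2 * Real.exp 0.527 := by
    rw [← Real.exp_nat_mul, ← Real.exp_add]; norm_num
  have h3 : Real.exp 0.527 ≤ 1.6943 := by
    refine (Real.exp_bound' (n := 6) (by norm_num) (by norm_num) (by norm_num)).trans ?_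
    norm_num [Finset.sum_range_succ, Nat.factorial]
  have h4 : Real.exp 1 ^ 2 ≤ 7.3891 := by nlinarith [Real.exp_pos 1]
  rw [h2]
  nlinarith [Real.exp_pos 1, Real.exp_pos 0.527]

lemma hasDerivAt_ofReal_add_cpow {m x : ℝ} (h : 0 < m + x) (c : ℂ) :
    HasDerivAt (fun y : ℝ => ((m + y : ℝ) : ℂ) ^ c) (c * ((m + x : ℝ) : ℂ) ^ (c - 1)) x := by
  have h1 : HasDerivAt (fun y : ℝ => ((m + y : ℝ) : ℂ)) 1 x := by
    simpa using ((hasDerivAt_id x).const_add m).ofReal_comp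
  have h2 : HasDerivAt (fun z : ℂ => z ^ c) (c * ((m + x : ℝ) : ℂ) ^ (c - 1))
      ((m + x : ℝ) : ℂ) := by
    simpa using (hasDerivAt_id ((m + x : ℝ) : ℂ)).cpow_const (c := c) (Or.inl (by
      simpa using h))
  have h3 := HasDerivAt.comp x h2 h1
  rw [mul_one] at h3
  exact h3

/-- Mean value bound for `t ↦ t ^ (-s)` on `[m, m + 1]`. -/
lemma norm_cpow_neg_sub_cpow_neg_le {m t : ℝ} (hm : 0 < m) (ht : t ∈ Icc (0 : ℝ) 1) {s : ℂ}
    (hs : 0 ≤ s.re) :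
    ‖((m + t : ℝ) : ℂ) ^ (-s) - (m : ℂ) ^ (-s)‖ ≤ ‖s‖ * m ^ (-s.re - 1) := by
  have hder : ∀ x ∈ Icc (0 : ℝ) 1, HasDerivWithinAt (fun x : ℝ => ((m + x : ℝ) : ℂ) ^ (-s))
      (-s * ((m + x : ℝ) : ℂ) ^ (-s - 1)) (Icc 0 1) x := by
    intro x hx
    have hpos : 0 < m + x := by linarith [hx.1]
    exact (hasDerivAt_ofReal_add_cpow hpos (-s)).hasDerivWithinAt
  have hbd : ∀ x ∈ Ico (0 : ℝ) 1, ‖-s * ((m + x : ℝ) : ℂ) ^ (-s - 1)‖ ≤ ‖s‖ * m ^ (-s.re - 1) := by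
    intro x hx
    have hpos : 0 < m + x := by linarith [hx.1]
    rw [norm_mul, norm_neg, norm_cpow_eq_rpow_re_of_pos hpos]
    simp only [sub_re, neg_re, one_re]
    gcongr ‖s‖ * ?_
    exact Real.rpow_le_rpow_of_nonpos hm (by linarith [hx.1]) (by linarith)
  have h := norm_image_sub_le_of_norm_deriv_le_segment' hder hbd t ht
  simp only [add_zero] at h
  refine h.trans ?_
  have : 0 ≤ ‖s‖ * m ^ (-s.re - 1) := by positivity
  nlinarith [ht.1, ht.2]

/-- The terms of the Euler–Maclaurin type series for `(s - 1) ζ(s) - 1`. -/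
noncomputable def zetaTerm (n : ℕ) (s : ℂ) : ℂ :=
  (s - 1) * ((n + 1 : ℝ) : ℂ) ^ (-s) +
    (((n + 2 : ℝ) : ℂ) ^ (1 - s) - ((n + 1 : ℝ) : ℂ) ^ (1 - s))

lemma norm_zetaTerm_le (n : ℕ) {s : ℂ} (hs : 0 ≤ s.re) :
    ‖zetaTerm n s‖ ≤ ‖s - 1‖ * ‖s‖ * (n + 1 : ℝ) ^ (-s.re - 1) := by
  set m : ℝ := n + 1 with hm
  have hm0 : 0 < m := by positivity
  have hder : ∀ x ∈ Icc (0 : ℝ) 1, HasDerivWithinAt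
      (fun x : ℝ => (s - 1) * (m : ℂ) ^ (-s) * x + ((m + x : ℝ) : ℂ) ^ (1 - s))
      ((s - 1) * ((m : ℂ) ^ (-s) - ((m + x : ℝ) : ℂ) ^ (-s))) (Icc 0 1) x := by
    intro x hx
    have hpos : 0 < m + x := by linarith [hx.1]
    have h2 := hasDerivAt_ofReal_add_cpow hpos (1 - s)
    have h3 : HasDerivAt (fun y : ℝ => (y : ℂ)) 1 x := by
      simpa using (hasDerivAt_id x).ofReal_comp
    have h4 := (h3.const_mul ((s - 1) * (m : ℂ) ^ (-s))).add h2
    refine (h4.congr_deriv ?_).hasDerivWithinAt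
    rw [show (1 - s - 1) = -s by ring]
    ring
  have h := norm_image_sub_le_of_norm_deriv_le_segment' hder
    (C := ‖s - 1‖ * (‖s‖ * m ^ (-s.re - 1))) (fun x hx => by
      rw [norm_mul, norm_sub_rev ((m : ℂ) ^ (-s))]
      gcongr
      exact norm_cpow_neg_sub_cpow_neg_le hm0 ⟨hx.1, hx.2.le⟩ hs) 1 (by simp)
  have e : zetaTerm n s = (s - 1) * (m : ℂ) ^ (-s) * ((1 : ℝ) : ℂ) + ((m + 1 : ℝ) : ℂ) ^ (1 - s) -
      ((s - 1) * (m : ℂ) ^ (-s) * ((0 : ℝ) : ℂ) + ((m + 0 : ℝ) : ℂ) ^ (1 - s)) := by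
    rw [zetaTerm, hm, show ((n : ℝ) + 1 + 1) = n + 2 by ring]
    simp
    ring
  rw [e]
  refine h.trans (le_of_eq ?_)
  ring

lemma summable_nat_add_one_rpow {σ : ℝ} (hσ : 0 < σ) :
    Summable fun n : ℕ => (n + 1 : ℝ) ^ (-σ - 1) := by
  have h := (summable_nat_add_iff 1).mpr (Real.summable_nat_rpow.mpr (by linarith : -σ - 1 < -1))
  simpa using h

lemma differentiable_zetaTerm (n : ℕ) : Differentiable ℂ (zetaTerm n) := by
  intro s
  unfold zetaTerm
  have h1 : ((n + 1 : ℝ) : ℂ) ≠ 0 := by norm_cast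
  have h2 : ((n + 2 : ℝ) : ℂ) ≠ 0 := by norm_cast
  have e1 : DifferentiableAt ℂ (fun s : ℂ => ((n + 1 : ℝ) : ℂ) ^ (-s)) s :=
    (differentiableAt_id.neg).const_cpow (Or.inl h1)
  have e2 : DifferentiableAt ℂ (fun s : ℂ => ((n + 2 : ℝ) : ℂ) ^ (1 - s)) s :=
    (differentiableAt_id.const_sub 1).const_cpow (Or.inl h2)
  have e3 : DifferentiableAt ℂ (fun s : ℂ => ((n + 1 : ℝ) : ℂ) ^ (1 - s)) s :=
    (differentiableAt_id.const_sub 1).const_cpow (Or.inl h1)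
  exact ((differentiableAt_id.sub_const 1).mul e1).add (e2.sub e3)

lemma differentiableOn_tsum_zetaTerm :
    DifferentiableOn ℂ (fun s => ∑' n, zetaTerm n s) {s | 0 < s.re} := by
  intro s hs
  have hs : 0 < s.re := hs
  have hopen : IsOpen {w : ℂ | s.re / 2 < w.re ∧ ‖w‖ < ‖s‖ + 1} :=
    (isOpen_lt continuous_const continuous_re).inter (isOpen_lt continuous_norm continuous_const)
  have h := differentiableOn_tsum_of_summable_norm (F := zetaTerm)
    (u := fun n : ℕ => (‖s‖ + 2) * (‖s‖ + 1) * (n + 1 : ℝ) ^ (-(s.re / 2) - 1))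
    ((summable_nat_add_one_rpow (by linarith)).mul_left _)
    (fun n => (differentiable_zetaTerm n).differentiableOn) hopen (by
      rintro n w ⟨hw1, hw2⟩
      refine (norm_zetaTerm_le n (by linarith)).trans ?_
      have h1 : ‖w - 1‖ ≤ ‖s‖ + 2 := by
        have := norm_sub_le w 1
        simp only [norm_one] at this
        linarith
      gcongr
      linarith)
  exact (h.differentiableAt (hopen.mem_nhds ⟨by linarith, by linarith⟩)).differentiableWithinAt

lemma sub_one_mul_riemannZeta_eq_of_one_lt {s : ℂ} (hs : 1 < s.re) :
    (s - 1) * riemannZeta s = 1 + ∑' n, zetaTerm n s := by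
  have h1 : HasSum (fun n : ℕ => ((n + 1 : ℝ) : ℂ) ^ (-s)) (riemannZeta s) := by
    rw [zeta_eq_tsum_one_div_nat_add_one_cpow hs]
    have hsum : Summable fun n : ℕ => 1 / ((n : ℂ) + 1) ^ s := by
      have := (summable_nat_add_iff 1).mpr (Complex.summable_one_div_nat_cpow.mpr hs)
      simpa using this
    convert hsum.hasSum using 2 with n
    rw [cpow_neg, one_div]
    push_cast
    rfl
  have h2 : HasSum (fun n : ℕ => ((n + 2 : ℝ) : ℂ) ^ (1 - s) - ((n + 1 : ℝ) : ℂ) ^ (1 - s))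
      (0 - 1) := by
    have ht : Tendsto (fun n : ℕ => ((n + 1 : ℝ) : ℂ) ^ (1 - s)) atTop (𝓝 0) := by
      rw [tendsto_zero_iff_norm_tendsto_zero]
      have hr : Tendsto (fun n : ℕ => (n + 1 : ℝ) ^ (-(s.re - 1))) atTop (𝓝 0) :=
        (tendsto_rpow_neg_atTop (by linarith)).comp
          (tendsto_natCast_atTop_atTop.atTop_add tendsto_const_nhds)
      refine hr.congr fun n => ?_
      rw [norm_cpow_eq_rpow_re_of_pos (by positivity)]
      simp
    have hs2 : Summable fun n : ℕ =>
        ((n + 2 : ℝ) : ℂ) ^ (1 - s) - ((n + 1 : ℝ) : ℂ) ^ (1 - s) := by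
      have hz : Summable fun n => zetaTerm n s := by
        refine Summable.of_norm_bounded (g := fun n : ℕ => ‖s - 1‖ * ‖s‖ * (n + 1 : ℝ) ^ (-s.re - 1))
          ((summable_nat_add_one_rpow (by linarith)).mul_left _)
          fun n => norm_zetaTerm_le n (by linarith)
      refine (hz.sub (h1.summable.mul_left (s - 1))).congr fun n => ?_
      rw [zetaTerm]
      ring
    refine (hs2.hasSum_iff_tendsto_nat).mpr ?_
    have := ht.sub_const (((0 : ℕ) + 1 : ℝ) : ℂ)
    have e : ∀ n : ℕ, ∑ i ∈ Finset.range n,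
        (((i + 2 : ℝ) : ℂ) ^ (1 - s) - ((i + 1 : ℝ) : ℂ) ^ (1 - s)) =
        ((n + 1 : ℝ) : ℂ) ^ (1 - s) - 1 := by
      intro n
      have := Finset.sum_range_sub (fun i : ℕ => ((i + 1 : ℝ) : ℂ) ^ (1 - s)) n
      rw [← Finset.sum_congr rfl (fun i _ => ?_), this]
      · simp
      · simp [add_assoc, one_add_one_eq_two]
    simp_rw [e]
    exact ht.sub_const 1
  have h3 := ((h1.mul_left (s - 1)).add h2).tsum_eq
  have e : ∑' n, zetaTerm n s = (s - 1) * riemannZeta s + (0 - 1) := h3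
  rw [e]
  ring

/-- `(s - 1) ζ(s)`, with its removable singularity at `1` filled in (for `0 < re s`). -/
noncomputable def zetaReg (s : ℂ) : ℂ := 1 + ∑' n, zetaTerm n s

lemma differentiableOn_zetaReg : DifferentiableOn ℂ zetaReg {s | 0 < s.re} :=
  differentiableOn_tsum_zetaTerm.const_add 1

lemma xiFun_eq_zetaReg_mul {s : ℂ} (hs : 0 < s.re) :
    xiFun s = zetaReg s * (2 * (Real.pi : ℂ) ^ (-s / 2) * Gamma (s / 2 + 1)) := by
  have hconv : IsPreconnected {s : ℂ | 0 < s.re} := (convex_halfSpace_re_gt 0).isPreconnected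
  have hopen : IsOpen {s : ℂ | 0 < s.re} := isOpen_lt continuous_const continuous_re
  -- multiply by the nonvanishing completing factor to remove the point `1`
  have h := AnalyticOnNhd.eqOn_of_preconnected_of_eventuallyEq (𝕜 := ℂ)
    (f := xiFun) (g := fun s => zetaReg s * (2 * (Real.pi : ℂ) ^ (-s / 2) * Gamma (s / 2 + 1))) (U := {s : ℂ | 0 < s.re})
    (differentiable_xiFun.differentiableOn.analyticOnNhd hopen) (by
      refine DifferentiableOn.analyticOnNhd ?_ hopen
      refine (differentiableOn_zetaReg).mul fun w hw => ?_
      have hw : 0 < w.re := hw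
      refine DifferentiableAt.differentiableWithinAt ?_
      have hG : DifferentiableAt ℂ (fun s : ℂ => Gamma (s / 2 + 1)) w := by
        refine DifferentiableAt.comp w (g := Gamma) (differentiableAt_Gamma _ fun m hm => ?_)
          (by fun_prop)
        have := congrArg re hm
        simp at this
        linarith [(m.cast_nonneg : (0 : ℝ) ≤ m)]
      have hp : DifferentiableAt ℂ (fun s : ℂ => (Real.pi : ℂ) ^ (-s / 2)) w := by
        refine DifferentiableAt.const_cpow (by fun_prop) (Or.inl ?_)
        exact_mod_cast Real.pi_ne_zero
      exact (hp.const_mul 2).mul hG) hconv (z₀ := 2) (by simp) (by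
      have : {s : ℂ | 1 < s.re} ∈ 𝓝 (2 : ℂ) :=
        (isOpen_lt continuous_const continuous_re).mem_nhds (by simp)
      filter_upwards [this] with w hw
      have hw : 1 < w.re := hw
      rw [xiFun_eq (by linarith) (by rintro rfl; simp at hw),
        sub_one_mul_riemannZeta_eq_of_one_lt hw, zetaReg])
  exact h hs

lemma sub_one_mul_riemannZeta_eq {s : ℂ} (hs : 0 < s.re) (hs1 : s ≠ 1) :
    (s - 1) * riemannZeta s = zetaReg s := by
  have h := xiFun_eq_zetaReg_mul hs
  rw [xiFun_eq hs hs1] at h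
  exact mul_right_cancel₀ (two_mul_pi_cpow_mul_Gamma_ne_zero hs) h

lemma zetaReg_ne_zero (hRH : RiemannHypothesis) {s : ℂ} (hs : 1 / 2 < s.re) :
    zetaReg s ≠ 0 := by
  intro h
  refine xiFun_ne_zero hRH hs ?_
  rw [xiFun_eq_zetaReg_mul (by linarith), h, zero_mul]

lemma norm_zetaReg_le {σ : ℝ} (hσ : 0 < σ) :
    ∃ C : ℝ, 1 ≤ C ∧ ∀ s : ℂ, σ ≤ s.re → ‖zetaReg s‖ ≤ C * (1 + ‖s‖) ^ 2 := by
  refine ⟨1 + ∑' n : ℕ, (n + 1 : ℝ) ^ (-σ - 1), by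
    have : 0 ≤ ∑' n : ℕ, (n + 1 : ℝ) ^ (-σ - 1) := tsum_nonneg fun n => by positivity
    linarith, fun s hs => ?_⟩
  have hsum := summable_nat_add_one_rpow hσ
  have hb : ‖∑' n, zetaTerm n s‖ ≤ ‖s - 1‖ * ‖s‖ * ∑' n : ℕ, (n + 1 : ℝ) ^ (-σ - 1) := by
    refine tsum_of_norm_bounded (hsum.hasSum.mul_left _) fun n => ?_
    refine (norm_zetaTerm_le n (by linarith)).trans ?_
    gcongr
    simp
  have h1 : ‖s - 1‖ ≤ ‖s‖ + 1 := by simpa using norm_sub_le s 1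
  have h2 : 0 ≤ ∑' n : ℕ, (n + 1 : ℝ) ^ (-σ - 1) := tsum_nonneg fun n => by positivity
  have h0 := norm_nonneg s
  calc ‖zetaReg s‖ ≤ 1 + ‖∑' n, zetaTerm n s‖ := by
        rw [zetaReg]; simpa using norm_add_le 1 (∑' n, zetaTerm n s)
    _ ≤ 1 + (‖s‖ + 1) * ‖s‖ * ∑' n : ℕ, (n + 1 : ℝ) ^ (-σ - 1) := by
        refine add_le_add le_rfl (hb.trans ?_)
        gcongr
    _ ≤ _ := by
        have h3 : (‖s‖ + 1) * ‖s‖ ≤ (1 + ‖s‖) ^ 2 := by nlinarith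
        have h4 : 1 ≤ (1 + ‖s‖) ^ 2 := by nlinarith
        nlinarith [mul_le_mul_of_nonneg_right h3 h2]

/-- A zero-free holomorphic function bounded above on a disc is bounded below inside the disc. -/
lemma norm_mul_exp_le_of_ne_zero {f : ℂ → ℂ} {c z : ℂ} {R M : ℝ} (hM : 0 < M)
    (hf : DifferentiableOn ℂ f (Metric.ball c R)) (h0 : ∀ w ∈ Metric.ball c R, f w ≠ 0)
    (hb : ∀ w ∈ Metric.ball c R, ‖f w‖ ≤ Real.exp M * ‖f c‖) (hz : z ∈ Metric.ball c R) :
    ‖f c‖ * Real.exp (-(2 * M * ‖z - c‖ / (R - ‖z - c‖))) ≤ ‖f z‖ := by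
  have hR : 0 < R := Metric.pos_of_mem_ball hz
  have hc : c ∈ Metric.ball c R := Metric.mem_ball_self hR
  have hd : DifferentiableOn ℂ (fun w => deriv f w / f w) (Metric.ball c R) :=
    (hf.deriv Metric.isOpen_ball).div hf h0
  obtain ⟨g, hgc, hg⟩ := hd.isExactOn_ball.with_val_at c (0 : ℂ)
  have hconst : ∀ w ∈ Metric.ball c R, f w = f c * Complex.exp (g w) := by
    intro w hw
    have hder : ∀ u ∈ Metric.ball c R,
        HasDerivAt (fun u => f u * Complex.exp (-g u)) 0 u := by
      intro u hu
      have h1 := (hf.differentiableAt (Metric.isOpen_ball.mem_nhds hu)).hasDerivAt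
      have h2 := (hg u hu).neg.cexp
      refine (h1.mul h2).congr_deriv ?_
      field_simp [h0 u hu]
      ring
    have h := (convex_ball c R).is_const_of_fderivWithin_eq_zero (𝕜 := ℂ)
      (f := fun u => f u * Complex.exp (-g u))
      (fun u hu => (hder u hu).differentiableAt.differentiableWithinAt) (fun u hu => by
        rw [fderivWithin_of_isOpen Metric.isOpen_ball hu, (hder u hu).hasFDerivAt.fderiv]
        ext
        simp) hw hc
    simp only [hgc, neg_zero, Complex.exp_zero, mul_one] at h
    rw [← h, mul_assoc, ← Complex.exp_add, neg_add_cancel, Complex.exp_zero, mul_one]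
  have hfc : 0 < ‖f c‖ := norm_pos_iff.mpr (h0 c hc)
  have hmem : ∀ w ∈ Metric.ball (0 : ℂ) R, c + w ∈ Metric.ball c R := by
    intro w hw
    simpa [Metric.mem_ball, dist_eq_norm] using hw
  have hB := borelCaratheodory_zero (f := fun w => g (c + w)) (M := M) (R := R) (z := z - c) hM
    (fun w hw => by
      have := (hg _ (hmem w hw)).differentiableAt
      refine DifferentiableAt.differentiableWithinAt ?_
      exact DifferentiableAt.comp w (g := g) (f := fun w => c + w) this (by fun_prop))
    (fun w hw => by
      have h1 := hb _ (hmem w hw)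
      rw [hconst _ (hmem w hw), norm_mul, Complex.norm_exp, mul_comm] at h1
      exact Real.exp_le_exp.mp (le_of_mul_le_mul_right h1 hfc))
    hR (by simpa [Metric.mem_ball, dist_eq_norm] using hz) (by simpa using hgc)
  simp only [add_sub_cancel] at hB
  rw [hconst z hz, norm_mul, Complex.norm_exp]
  gcongr
  have := (abs_re_le_norm (g z))
  have := neg_abs_le (g z).re
  linarith

lemma third_le_norm_zetaReg {s : ℂ} (hs : 2 ≤ s.re) : 1 / 3 ≤ ‖zetaReg s‖ := by
  have hs1 : s ≠ 1 := by rintro rfl; norm_num at hs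
  rw [← sub_one_mul_riemannZeta_eq (by linarith) hs1, norm_mul]
  have h1 : 1 ≤ ‖s - 1‖ := by
    have := (le_abs_self _).trans (abs_re_le_norm (s - 1))
    simp only [sub_re, one_re] at this
    linarith
  have hsum : HasSum (fun n : ℕ => 1 / ((n : ℝ) + 1) ^ 2) (Real.pi ^ 2 / 6) := by
    have := (hasSum_nat_add_iff (f := fun n : ℕ => 1 / (n : ℝ) ^ 2) 1).mpr
      (by simpa using hasSum_zeta_two)
    simpa using this
  have hsum2 : HasSum (fun n : ℕ => 1 / ((n : ℝ) + 1 + 1) ^ 2) (Real.pi ^ 2 / 6 - 1) := by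
    have := (hasSum_nat_add_iff (f := fun n : ℕ => 1 / ((n : ℝ) + 1) ^ 2) 1
      (g := Real.pi ^ 2 / 6 - 1)).mpr (by simpa using hsum)
    simpa using this
  have hz : HasSum (fun n : ℕ => 1 / ((n : ℂ) + 1) ^ s) (riemannZeta s) := by
    rw [zeta_eq_tsum_one_div_nat_add_one_cpow (by linarith)]
    have := (summable_nat_add_iff 1).mpr (Complex.summable_one_div_nat_cpow.mpr
      (by linarith : 1 < s.re))
    simpa using this.hasSum
  have hz2 : HasSum (fun n : ℕ => 1 / ((n : ℂ) + 1 + 1) ^ s) (riemannZeta s - 1) := by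
    have := (hasSum_nat_add_iff (f := fun n : ℕ => 1 / ((n : ℂ) + 1) ^ s) 1
      (g := riemannZeta s - 1)).mpr (by simpa using hz)
    simpa using this
  have h2 : ‖riemannZeta s - 1‖ ≤ Real.pi ^ 2 / 6 - 1 := by
    rw [← hz2.tsum_eq]
    refine tsum_of_norm_bounded hsum2 fun n => ?_
    have e : ((n : ℂ) + 1 + 1) = ((n + 1 + 1 : ℝ) : ℂ) := by push_cast; rfl
    rw [norm_div, norm_one, e, norm_cpow_eq_rpow_re_of_pos (by positivity), ← Real.rpow_natCast]
    gcongr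
    · have : (0 : ℝ) ≤ n := n.cast_nonneg
      linarith
    · simpa using hs
  have h3 : 1 - ‖riemannZeta s - 1‖ ≤ ‖riemannZeta s‖ := by
    have := norm_sub_norm_le 1 (1 - riemannZeta s)
    rw [norm_one, norm_sub_rev, sub_sub_cancel] at this
    exact this
  have := Real.pi_lt_d2
  have := Real.pi_pos
  nlinarith [norm_nonneg (riemannZeta s)]

lemma norm_inv_zetaReg_le (hRH : RiemannHypothesis) {a : ℝ} (ha : 0 < a) :
    ∃ (C : ℝ) (k : ℕ), 1 ≤ C ∧ ∀ s : ℂ, 1 / 2 + a ≤ s.re → ‖zetaReg s‖⁻¹ ≤ C * (1 + ‖s‖) ^ k := by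
  obtain ⟨C, hC, hCs⟩ := norm_zetaReg_le (σ := 1 / 2) (by norm_num)
  obtain ⟨k, hk⟩ := exists_nat_ge (3 / a)
  refine ⟨3 * (75 * C) ^ k, 2 * k, ?_, fun s hs => ?_⟩
  · have := one_le_pow₀ (n := k) (by linarith : 1 ≤ 75 * C)
    linarith
  set X : ℝ := 75 * C * (1 + ‖s‖) ^ 2 with hX
  have hs0 := norm_nonneg s
  have hX1 : 75 ≤ X := by
    have : 1 ≤ (1 + ‖s‖) ^ 2 := one_le_pow₀ (by linarith)
    nlinarith
  rw [show 3 * (75 * C) ^ k * (1 + ‖s‖) ^ (2 * k) = 3 * X ^ k by rw [hX, mul_pow (75 * C), pow_mul, mul_assoc]]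
  suffices h : 1 / 3 * (X ^ k)⁻¹ ≤ ‖zetaReg s‖ by
    have hp : 0 < 1 / 3 * (X ^ k)⁻¹ := by positivity
    refine (inv_anti₀ hp h).trans (le_of_eq ?_)
    rw [mul_inv, inv_inv]
    norm_num
  rcases le_or_gt 2 s.re with h2 | h2
  · have h1 := third_le_norm_zetaReg h2
    have : (X ^ k)⁻¹ ≤ 1 := inv_le_one_of_one_le₀ (one_le_pow₀ (by linarith))
    linarith
  set c : ℂ := 2 + s.im * I with hc
  have hcre : c.re = 2 := by simp [hc]
  have hre : ∀ w ∈ Metric.ball c (3 / 2), 1 / 2 < w.re := by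
    intro w hw
    rw [Metric.mem_ball, dist_eq_norm] at hw
    have := (neg_le_abs _).trans (abs_re_le_norm (w - c))
    simp only [sub_re, hcre] at this
    linarith
  have hcs : ‖s - c‖ = 2 - s.re := by
    have : s - c = ((s.re - 2 : ℝ) : ℂ) := by
      apply Complex.ext <;> simp [hc]
    rw [this, norm_real, Real.norm_eq_abs, abs_of_neg (by linarith)]
    ring
  have hcn : ‖c‖ ≤ 2 + ‖s‖ := by
    refine (norm_add_le _ _).trans ?_
    simpa using abs_im_le_norm s
  have hz : s ∈ Metric.ball c (3 / 2) := by
    rw [Metric.mem_ball, dist_eq_norm, hcs]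
    linarith
  have hfc := third_le_norm_zetaReg hcre.ge
  have h := norm_mul_exp_le_of_ne_zero (f := zetaReg) (c := c) (z := s) (R := 3 / 2)
    (M := Real.log X) (Real.log_pos (by linarith))
    (differentiableOn_zetaReg.mono fun w hw => by
      have := hre w hw
      show 0 < w.re
      linarith)
    (fun w hw => zetaReg_ne_zero hRH (hre w hw))
    (fun w hw => by
      rw [Real.exp_log (by linarith)]
      refine (hCs w (hre w hw).le).trans ?_
      have hw' : ‖w‖ ≤ 4 + ‖s‖ := by
        rw [Metric.mem_ball, dist_eq_norm] at hw
        have := norm_sub_norm_le w c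
        linarith
      have h5 : (1 + ‖w‖) ^ 2 ≤ (5 * (1 + ‖s‖)) ^ 2 := by
        gcongr
        linarith
      calc C * (1 + ‖w‖) ^ 2 ≤ C * (5 * (1 + ‖s‖)) ^ 2 := by gcongr
        _ = X * (1 / 3) := by rw [hX]; ring
        _ ≤ X * ‖zetaReg c‖ := by gcongr) hz
  refine le_trans ?_ h
  have he : (X ^ k)⁻¹ ≤ Real.exp (-(2 * Real.log X * ‖s - c‖ / (3 / 2 - ‖s - c‖))) := by
    rw [Real.exp_neg]
    refine inv_anti₀ (Real.exp_pos _) ?_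
    rw [← Real.exp_log (show 0 < X ^ k by positivity), Real.log_pow, Real.exp_le_exp]
    have hl : 0 < Real.log X := Real.log_pos (by linarith)
    rw [hcs, div_le_iff₀ (by linarith)]
    have h3 : 3 ≤ k * a := by rwa [div_le_iff₀ ha] at hk
    have h4 : (k : ℝ) * a ≤ k * (3 / 2 - (2 - s.re)) := by
      gcongr
      linarith
    nlinarith
  gcongr

lemma norm_betaIntegral_le {u : ℂ} {a : ℝ} (ha : 0 < a) (hu : 1 ≤ u.re) :
    ‖betaIntegral u a‖ ≤ 1 / a := by
  have hI : IntervalIntegrable (fun x : ℝ => (1 - x) ^ (a - 1)) volume 0 1 := by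
    have := (intervalIntegral.intervalIntegrable_rpow' (r := a - 1) (a := 1) (b := 0)
      (by linarith)).comp_sub_left 1
    simpa using this
  have h := intervalIntegral.norm_integral_le_of_norm_le (zero_le_one' ℝ)
    (f := fun x : ℝ => (x : ℂ) ^ (u - 1) * (1 - (x : ℂ)) ^ ((a : ℂ) - 1))
    (g := fun x : ℝ => (1 - x) ^ (a - 1)) (μ := volume) (by
      filter_upwards [Measure.ae_ne volume (1 : ℝ)] with x hx1 hx
      have h0 : 0 < x := hx.1
      have h1 : 0 < 1 - x := by
        have := lt_of_le_of_ne hx.2 hx1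
        linarith
      have e : (1 - (x : ℂ)) = ((1 - x : ℝ) : ℂ) := by push_cast; rfl
      rw [norm_mul, e, norm_cpow_eq_rpow_re_of_pos h0, norm_cpow_eq_rpow_re_of_pos h1]
      simp only [sub_re, one_re, ofReal_re]
      have := Real.rpow_le_one h0.le hx.2 (by linarith : 0 ≤ u.re - 1)
      have h2 : 0 ≤ (1 - x) ^ (a - 1) := by positivity
      nlinarith) hI
  refine h.trans (le_of_eq ?_)
  have := intervalIntegral.integral_comp_sub_left (fun x : ℝ => x ^ (a - 1)) (a := 0) (b := 1) 1
  rw [this, sub_self, sub_zero, integral_rpow (Or.inl (by linarith))]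
  simp [Real.zero_rpow ha.ne']

lemma Gamma_div_Gamma_add {u : ℂ} {a : ℝ} (ha : 0 < a) (hu : 0 < u.re) :
    Gamma u / Gamma (u + a) = betaIntegral u a / Gamma a := by
  have h1 : Gamma (u + a) ≠ 0 := Gamma_ne_zero_of_re_pos (by simp; linarith)
  have h2 : Gamma (a : ℂ) ≠ 0 := Gamma_ne_zero_of_re_pos (by simpa using ha)
  rw [div_eq_div_iff h1 h2, Gamma_mul_Gamma_eq_betaIntegral hu (by simpa using ha), mul_comm]

lemma norm_Gamma_div_Gamma_add_le {a : ℝ} (ha : 0 < a) :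
    ∃ K : ℝ, 0 < K ∧ ∀ u : ℂ, 1 ≤ u.re → ‖Gamma u / Gamma (u + a)‖ ≤ K := by
  have h2 : 0 < ‖Gamma (a : ℂ)‖ :=
    norm_pos_iff.mpr (Gamma_ne_zero_of_re_pos (by simpa using ha))
  refine ⟨1 / a / ‖Gamma (a : ℂ)‖, by positivity, fun u hu => ?_⟩
  rw [Gamma_div_Gamma_add ha (by linarith), norm_div]
  gcongr
  exact norm_betaIntegral_le ha hu

lemma norm_ofReal_cpow_sub_cpow_le {x m : ℝ} (hx : x ∈ Ioc (0 : ℝ) 1) {u v : ℂ} (hu : m ≤ u.re)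
    (hv : m ≤ v.re) :
    ‖(x : ℂ) ^ (u - 1) - (x : ℂ) ^ (v - 1)‖ ≤ ‖u - v‖ * (x ^ (m - 2) * (1 - x)) := by
  have hx0 := hx.1
  have hxc : (x : ℂ) ≠ 0 := by exact_mod_cast hx0.ne'
  have h := (convex_halfSpace_re_ge m).norm_image_sub_le_of_norm_hasDerivWithin_le
    (𝕜 := ℂ) (f := fun w : ℂ => (x : ℂ) ^ (w - 1))
    (f' := fun w : ℂ => (x : ℂ) ^ (w - 1) * Complex.log x) (C := x ^ (m - 2) * (1 - x))
    (x := v) (y := u)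
    (fun w _ => by
      have := ((hasDerivAt_id w).sub_const 1).const_cpow (c := (x : ℂ)) (Or.inl hxc)
      simpa using this.hasDerivWithinAt)
    (fun w hw => by
      have hw : m ≤ w.re := hw
      rw [norm_mul, norm_cpow_eq_rpow_re_of_pos hx0, ← ofReal_log hx0.le, norm_real,
        Real.norm_eq_abs, abs_of_nonpos (Real.log_nonpos hx0.le hx.2)]
      have h1 : -Real.log x ≤ x⁻¹ * (1 - x) := by
        have := Real.one_sub_inv_le_log_of_pos hx0
        rw [mul_sub, inv_mul_cancel₀ hx0.ne']
        linarith
      have h2 : x ^ ((w - 1).re) ≤ x ^ (m - 1) :=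
        Real.rpow_le_rpow_of_exponent_ge hx0 hx.2 (by simpa using hw)
      have h3 : x ^ (m - 2) = x ^ (m - 1) * x⁻¹ := by
        rw [← Real.rpow_neg_one, ← Real.rpow_add hx0]
        ring_nf
      rw [h3, mul_assoc]
      have := Real.log_nonpos hx0.le hx.2
      gcongr
      linarith) hv hu
  rw [mul_comm] at h
  exact h

lemma norm_betaIntegral_sub_le {u v : ℂ} {a m : ℝ} (ha : 0 < a) (hm : 1 < m) (hu : m ≤ u.re)
    (hv : m ≤ v.re) : ‖betaIntegral u a - betaIntegral v a‖ ≤ ‖u - v‖ / (m - 1) := by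
  have har : 0 < (a : ℂ).re := by simpa using ha
  rw [betaIntegral, betaIntegral, ← intervalIntegral.integral_sub
    (betaIntegral_convergent (by linarith) har) (betaIntegral_convergent (by linarith) har)]
  have h := intervalIntegral.norm_integral_le_of_norm_le (zero_le_one' ℝ)
    (f := fun x : ℝ => (x : ℂ) ^ (u - 1) * (1 - (x : ℂ)) ^ ((a : ℂ) - 1) -
      (x : ℂ) ^ (v - 1) * (1 - (x : ℂ)) ^ ((a : ℂ) - 1))
    (g := fun x : ℝ => ‖u - v‖ * x ^ (m - 2)) (μ := volume) (by
      filter_upwards [Measure.ae_ne volume (1 : ℝ)] with x hx1 hx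
      have h0 : 0 < x := hx.1
      have h1 : 0 < 1 - x := by
        have := lt_of_le_of_ne hx.2 hx1
        linarith
      have e : (1 - (x : ℂ)) = ((1 - x : ℝ) : ℂ) := by push_cast; rfl
      rw [← sub_mul, norm_mul, e, norm_cpow_eq_rpow_re_of_pos h1]
      simp only [sub_re, one_re, ofReal_re]
      have h2 := norm_ofReal_cpow_sub_cpow_le hx hu hv
      have h3 : (1 - x) * (1 - x) ^ (a - 1) ≤ 1 := by
        have : (1 - x) * (1 - x) ^ (a - 1) = (1 - x) ^ a := by
          nth_rewrite 1 [← Real.rpow_one (1 - x)]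
          rw [← Real.rpow_add h1]
          ring_nf
        rw [this]
        exact Real.rpow_le_one h1.le (by linarith) ha.le
      calc _ ≤ ‖u - v‖ * (x ^ (m - 2) * (1 - x)) * (1 - x) ^ (a - 1) := by gcongr
        _ = ‖u - v‖ * x ^ (m - 2) * ((1 - x) * (1 - x) ^ (a - 1)) := by ring
        _ ≤ ‖u - v‖ * x ^ (m - 2) * 1 := by gcongr
        _ = _ := mul_one _)
    ((intervalIntegral.intervalIntegrable_rpow' (by linarith)).const_mul _)
  refine h.trans (le_of_eq ?_)
  rw [intervalIntegral.integral_const_mul, integral_rpow (Or.inl (by linarith))]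
  rw [show m - 2 + 1 = m - 1 by ring, Real.zero_rpow (by linarith), Real.one_rpow, sub_zero]
  ring

lemma hasDerivAt_Gamma_div_Gamma_add {u : ℂ} (hu : 0 < u.re) :
    HasDerivAt (fun a : ℝ => Gamma u / Gamma (u + a)) (-digamma u) 0 := by
  have h0 : Gamma u ≠ 0 := Gamma_ne_zero_of_re_pos hu
  have hd : DifferentiableAt ℂ Gamma u := differentiableAt_Gamma _ fun m hm => by
    have := congrArg re hm
    simp at this
    linarith [(m.cast_nonneg : (0 : ℝ) ≤ m)]
  have h1 : HasDerivAt (fun w : ℂ => Gamma (u + w)) (deriv Gamma u) 0 := by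
    have := hd.hasDerivAt
    rw [← add_zero u] at this
    simpa using this.comp_const_add u 0
  have h2 := ((hasDerivAt_const (0 : ℂ) (Gamma u)).div h1 (by simpa using h0))
  have h3 : HasDerivAt (fun w : ℂ => Gamma u / Gamma (u + w)) (-digamma u) ((0 : ℝ) : ℂ) := by
    rw [ofReal_zero]
    refine h2.congr_deriv ?_
    rw [digamma, logDeriv_apply, add_zero]
    field_simp
    ring
  exact h3.comp_ofReal

lemma norm_digamma_sub_le {u v : ℂ} {m : ℝ} (hm : 1 < m) (hu : m ≤ u.re) (hv : m ≤ v.re) :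
    ‖digamma u - digamma v‖ ≤ ‖u - v‖ / (m - 1) := by
  have hd := (hasDerivAt_Gamma_div_Gamma_add (by linarith : 0 < u.re)).sub
    (hasDerivAt_Gamma_div_Gamma_add (by linarith : 0 < v.re))
  have h1 := hd.hasDerivWithinAt (s := Ioi 0)
  rw [hasDerivWithinAt_iff_tendsto_slope' (by simp)] at h1
  have h2 : Tendsto (fun a : ℝ => Gamma ((a : ℂ) + 1)) (𝓝[>] 0) (𝓝 1) := by
    have hc : ContinuousAt (fun a : ℝ => Gamma ((a : ℂ) + 1)) 0 := by
      refine ContinuousAt.comp (g := Gamma) (f := fun a : ℝ => (a : ℂ) + 1) ?_ (by fun_prop)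
      simp only [ofReal_zero, zero_add]
      exact (differentiableAt_Gamma_one).continuousAt
    have := hc.tendsto
    simp only [ofReal_zero, zero_add, Gamma_one] at this
    exact this.mono_left nhdsWithin_le_nhds
  have h3 := (h2.mul h1).norm
  rw [one_mul] at h3
  refine le_of_tendsto (x := 𝓝[>] (0 : ℝ)) (f := fun a : ℝ => ‖betaIntegral u a - betaIntegral v a‖) ?_
    (by
      filter_upwards [self_mem_nhdsWithin] with a ha
      exact norm_betaIntegral_sub_le ha hm hu hv)
  rw [← norm_neg, neg_sub]
  rw [show digamma v - digamma u = -digamma u - -digamma v by ring]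
  refine h3.congr' ?_
  filter_upwards [self_mem_nhdsWithin] with a ha
  have ha : 0 < a := ha
  have hac : (a : ℂ) ≠ 0 := by exact_mod_cast ha.ne'
  have hG : Gamma (a : ℂ) ≠ 0 := Gamma_ne_zero_of_re_pos (by simpa using ha)
  have hGu : Gamma u ≠ 0 := Gamma_ne_zero_of_re_pos (by linarith)
  have hGv : Gamma v ≠ 0 := Gamma_ne_zero_of_re_pos (by linarith)
  congr 1
  rw [slope_def_module]
  simp only [Pi.sub_apply, ofReal_zero, add_zero, sub_zero, div_self hGu, div_self hGv, sub_self]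
  rw [Gamma_div_Gamma_add ha (by linarith), Gamma_div_Gamma_add ha (by linarith),
    Gamma_add_one _ hac, real_smul]
  push_cast
  field_simp

/-- A **Phragmén–Lindelöf** principle on the closed right half-plane for functions of polynomial
growth. -/
lemma norm_le_one_of_polynomial_growth {f : ℂ → ℂ} {D : ℝ} {N : ℕ}
    (hf : DiffContOnCl ℂ f {z | 0 < z.re}) (hD : ∀ z : ℂ, 0 ≤ z.re → ‖f z‖ ≤ D * (1 + ‖z‖) ^ N)
    (hb : ∀ y : ℝ, ‖f (y * I)‖ ≤ 1) {z : ℂ} (hz : 0 ≤ z.re) : ‖f z‖ ≤ 1 := by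
  have hD0 : 0 ≤ D := by simpa using (norm_nonneg _).trans (hD 0 le_rfl)
  have hlow : ∀ ε : ℝ, 0 < ε → ε ≤ 1 → ∀ w : ℂ, 0 ≤ w.re →
      1 ≤ ‖1 + ε * w‖ ∧ ε / 2 * (1 + ‖w‖) ≤ ‖1 + ε * w‖ := by
    intro ε h0 h1 w hw
    have e : ‖1 + ε * w‖ ^ 2 = 1 + 2 * ε * w.re + ε ^ 2 * ‖w‖ ^ 2 := by
      rw [Complex.sq_norm, Complex.sq_norm, normSq_apply, normSq_apply]
      simp
      ring
    have h2 : 0 ≤ 2 * ε * w.re := by positivity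
    constructor
    · refine abs_le_of_sq_le_sq' ?_ (norm_nonneg _) |>.2
      nlinarith [sq_nonneg (ε * ‖w‖)]
    · refine abs_le_of_sq_le_sq' ?_ (norm_nonneg _) |>.2
      have h3 : ε ^ 2 ≤ 1 := by nlinarith
      nlinarith [mul_nonneg (sq_nonneg ε) (sq_nonneg (1 - ‖w‖))]
  have key : ∀ ε : ℝ, 0 < ε → ε ≤ 1 → ‖f z‖ ≤ ‖1 + (ε : ℂ) * z‖ ^ N := by
    intro ε h0 h1
    have hne : ∀ w : ℂ, 0 ≤ w.re → (1 + (ε : ℂ) * w) ≠ 0 := fun w hw h => by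
      have := (hlow ε h0 h1 w hw).1
      rw [h, norm_zero] at this
      linarith
    have hg : ∀ w : ℂ, 0 ≤ w.re → ‖f w / (1 + ε * w) ^ N‖ ≤ D * (2 / ε) ^ N := by
      intro w hw
      have h2 := (hlow ε h0 h1 w hw).2
      have hpos : 0 < ‖1 + (ε : ℂ) * w‖ := norm_pos_iff.mpr (hne w hw)
      rw [norm_div, norm_pow, div_le_iff₀ (by positivity), mul_assoc, ← mul_pow]
      refine (hD w hw).trans ?_
      gcongr
      calc 1 + ‖w‖ = 2 / ε * (ε / 2 * (1 + ‖w‖)) := by field_simp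
        _ ≤ _ := by gcongr
    have hcl : closure {w : ℂ | 0 < w.re} ⊆ {w : ℂ | 0 ≤ w.re} :=
      closure_minimal (fun w (hw : 0 < w.re) => hw.le) (isClosed_le continuous_const continuous_re)
    have hdiff : Differentiable ℂ fun w : ℂ => (1 + (ε : ℂ) * w) ^ N := by fun_prop
    have h := PhragmenLindelof.right_half_plane_of_bounded_on_real
      (f := fun w => f w / (1 + ε * w) ^ N) (C := 1) (z := z)
      ⟨hf.1.div hdiff.differentiableOn fun w hw => pow_ne_zero _ (hne w (le_of_lt hw)),
        hf.2.div hdiff.continuous.continuousOn fun w hw => pow_ne_zero _ (hne w (hcl hw))⟩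
      ⟨1, by norm_num, 0, by
        simp only [zero_mul, Real.exp_zero]
        refine Asymptotics.IsBigO.of_bound (D * (2 / ε) ^ N) ?_
        have : ∀ᶠ w : ℂ in Bornology.cobounded ℂ ⊓ 𝓟 {z : ℂ | 0 < z.re}, w ∈ {z : ℂ | 0 < z.re} :=
          mem_inf_of_right (mem_principal_self _)
        filter_upwards [this] with w hw
        simpa using hg w (le_of_lt hw)⟩
      (by
        refine isBoundedUnder_of_eventually_le (a := D * (2 / ε) ^ N) ?_
        filter_upwards [eventually_ge_atTop 0] with x hx
        exact hg x (by simpa using hx))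
      (fun y => by
        rw [norm_div, norm_pow]
        have h2 := (hlow ε h0 h1 (y * I) (by simp)).1
        exact div_le_one_of_le₀ ((hb y).trans (one_le_pow₀ h2)) (by positivity)) hz
    rw [norm_div, norm_pow, div_le_one₀] at h
    · exact h
    · have := norm_pos_iff.mpr (hne z hz)
      positivity
  have hlim : Tendsto (fun ε : ℝ => ‖1 + (ε : ℂ) * z‖ ^ N) (𝓝[>] 0) (𝓝 1) := by
    have : Continuous fun ε : ℝ => ‖1 + (ε : ℂ) * z‖ ^ N := by fun_prop
    simpa using (this.tendsto 0).mono_left nhdsWithin_le_nhds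
  refine ge_of_tendsto hlim ?_
  filter_upwards [Ioc_mem_nhdsGT (zero_lt_one' ℝ)] with ε hε
  exact key ε hε.1 hε.2

lemma norm_xiFun_div_le (hRH : RiemannHypothesis) {a : ℝ} (ha : 0 < a) (ha4 : a < 1 / 4) :
    ∃ (D : ℝ) (N : ℕ), ∀ z : ℂ, 0 ≤ z.re →
      ‖xiFun (1 / 2 + z - a) / xiFun (1 / 2 + z + a)‖ ≤ D * (1 + ‖z‖) ^ N := by
  obtain ⟨C₁, hC₁, h₁⟩ := norm_zetaReg_le (σ := 1 / 4) (by norm_num)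
  obtain ⟨C₂, k, hC₂, h₂⟩ := norm_inv_zetaReg_le hRH ha
  obtain ⟨K, hK, h₃⟩ := norm_Gamma_div_Gamma_add_le ha
  refine ⟨C₁ * 2 ^ 2 * (C₂ * 2 ^ k) * (Real.pi ^ a * K), 2 + k, fun z hz => ?_⟩
  have hr1 : 1 / 4 ≤ (1 / 2 + z - a : ℂ).re := by simp; linarith
  have hr2 : 1 / 2 + a ≤ (1 / 2 + z + a : ℂ).re := by simp; linarith
  have hn1 : 1 + ‖1 / 2 + z - (a : ℂ)‖ ≤ 2 * (1 + ‖z‖) := by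
    have e1 := norm_sub_le (1 / 2 + z) (a : ℂ)
    have e2 := norm_add_le (1 / 2) z
    rw [norm_real, Real.norm_of_nonneg ha.le] at e1
    have e3 : ‖(1 / 2 : ℂ)‖ = 1 / 2 := by norm_num
    linarith [norm_nonneg z]
  have hn2 : 1 + ‖1 / 2 + z + (a : ℂ)‖ ≤ 2 * (1 + ‖z‖) := by
    have e1 := norm_add_le (1 / 2 + z) (a : ℂ)
    have e2 := norm_add_le (1 / 2) z
    rw [norm_real, Real.norm_of_nonneg ha.le] at e1
    have e3 : ‖(1 / 2 : ℂ)‖ = 1 / 2 := by norm_num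
    linarith [norm_nonneg z]
  have hG := h₃ ((1 / 2 + z - a) / 2 + 1) (by
    simp only [add_re, one_re, div_ofNat_re]
    linarith)
  have e : (1 / 2 + z - a) / 2 + 1 + (a : ℂ) = (1 / 2 + z + a) / 2 + 1 := by ring
  rw [e] at hG
  have hpi : ‖(Real.pi : ℂ) ^ (-(1 / 2 + z - a) / 2) / (Real.pi : ℂ) ^ (-(1 / 2 + z + a) / 2)‖ =
      Real.pi ^ a := by
    rw [← cpow_sub _ _ (by exact_mod_cast Real.pi_ne_zero), norm_cpow_eq_rpow_re_of_pos Real.pi_pos]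
    congr 1
    simp
    ring
  rw [xiFun_eq_zetaReg_mul (by linarith), xiFun_eq_zetaReg_mul (by linarith)]
  have split : ∀ A B p q u v : ℂ, A * (2 * p * u) / (B * (2 * q * v)) =
      A * B⁻¹ * ((p / q) * (u / v)) := by
    intro A B p q u v
    rw [show A * (2 * p * u) / (B * (2 * q * v)) = (2 * (A * p * u)) / (2 * (B * q * v)) by ring_nf,
      mul_div_mul_left _ _ two_ne_zero]
    simp only [div_eq_mul_inv, mul_inv]
    ring
  rw [split, norm_mul, norm_mul, norm_mul, norm_inv, hpi]
  calc _ ≤ C₁ * (2 * (1 + ‖z‖)) ^ 2 * (C₂ * (2 * (1 + ‖z‖)) ^ k) * (Real.pi ^ a * K) := by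
        gcongr
        · exact (h₁ _ hr1).trans (by gcongr)
        · exact (h₂ _ hr2).trans (by gcongr)
    _ = _ := by rw [mul_pow, mul_pow _ _ k, pow_add]; ring

lemma norm_xiFun_sub_le (hRH : RiemannHypothesis) {a : ℝ} (ha : 0 < a) (ha4 : a < 1 / 4)
    {s : ℂ} (hs : 1 / 2 ≤ s.re) : ‖xiFun (s - a)‖ ≤ ‖xiFun (s + a)‖ := by
  obtain ⟨D, N, hD⟩ := norm_xiFun_div_le hRH ha ha4
  have hne : ∀ z : ℂ, 0 ≤ z.re → xiFun (1 / 2 + z + a) ≠ 0 := fun z hz =>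
    xiFun_ne_zero hRH (by simp; linarith)
  have hcl : closure {w : ℂ | 0 < w.re} ⊆ {w : ℂ | 0 ≤ w.re} :=
    closure_minimal (fun w (hw : 0 < w.re) => hw.le) (isClosed_le continuous_const continuous_re)
  have hd : DifferentiableOn ℂ (fun z : ℂ => xiFun (1 / 2 + z - a) / xiFun (1 / 2 + z + a))
      {z | 0 ≤ z.re} := by
    have := differentiable_xiFun
    refine DifferentiableOn.div (Differentiable.differentiableOn ?_)
      (Differentiable.differentiableOn ?_) fun z hz => hne z hz
    · exact this.comp (f := fun z : ℂ => 1 / 2 + z - a) (by fun_prop)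
    · exact this.comp (f := fun z : ℂ => 1 / 2 + z + a) (by fun_prop)
  have h := norm_le_one_of_polynomial_growth (z := s - 1 / 2)
    ⟨hd.mono fun z (hz : 0 < z.re) => hz.le, hd.continuousOn.mono hcl⟩ hD (fun y => by
      have h1 : (starRingEnd ℂ (1 / 2 + y * I + a)) = 1 - (1 / 2 + y * I - a) := by
        simp [map_ofNat]
        ring
      rw [norm_div, ← xiFun_one_sub, ← h1, xiFun_conj_of_re_pos (by simp; linarith)]
      rw [RCLike.norm_conj]
      exact div_self_le_one _) (by simpa using hs)
  have e : (1 / 2 + (s - 1 / 2) : ℂ) = s := by ring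
  have hpos := norm_pos_iff.mpr (hne (s - 1 / 2) (by simpa using hs))
  rw [norm_div, div_le_one₀ hpos, e] at h
  exact h

lemma re_logDeriv_xiFun_nonneg (hRH : RiemannHypothesis) {s : ℂ} (hs : 1 / 2 < s.re) :
    0 ≤ (logDeriv xiFun s).re := by
  have hx := xiFun_ne_zero hRH hs
  have hd := (differentiable_xiFun s).hasDerivAt
  -- the quotient `ξ(s + a) / ξ(s - a)` has modulus at least one
  have hd1 : HasDerivAt (fun a : ℂ => xiFun (s + a)) (deriv xiFun s) 0 := by
    rw [← add_zero s] at hd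
    simpa using hd.comp_const_add s 0
  have hd2 : HasDerivAt (fun a : ℂ => xiFun (s - a)) (-deriv xiFun s) 0 := by
    rw [← sub_zero s] at hd
    simpa using hd.comp_const_sub s 0
  have hq : HasDerivAt (fun a : ℂ => xiFun (s + a) / xiFun (s - a)) (2 * logDeriv xiFun s)
      ((0 : ℝ) : ℂ) := by
    rw [ofReal_zero]
    refine (hd1.div hd2 (by simpa using hx)).congr_deriv ?_
    rw [logDeriv_apply]
    simp only [add_zero, sub_zero]
    field_simp
    ring
  have hq2 := hq.comp_ofReal
  have hn := hq2.norm_sq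
  simp only [ofReal_zero, add_zero, sub_zero, div_self hx] at hn
  have hn2 := hn.hasDerivWithinAt (s := Ioi 0)
  rw [hasDerivWithinAt_iff_tendsto_slope' (by simp)] at hn2
  have h := ge_of_tendsto (b := 0) hn2 (by
    filter_upwards [Ioo_mem_nhdsGT (by norm_num : (0 : ℝ) < 1 / 4),
      (show ∀ᶠ a : ℝ in 𝓝[>] 0, xiFun (s - a) ≠ 0 from by
        have hc : Continuous fun a : ℝ => xiFun (s - a) :=
          differentiable_xiFun.continuous.comp (by fun_prop)
        exact (hc.continuousAt.eventually_ne (by simpa using hx)).filter_mono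
          nhdsWithin_le_nhds)] with a ha hne
    have h1 := norm_xiFun_sub_le hRH ha.1 ha.2 hs.le
    rw [slope_def_field]
    simp only [ofReal_zero, add_zero, sub_zero, div_self hx, norm_one]
    refine div_nonneg ?_ ha.1.le
    have h2 : 1 ≤ ‖xiFun (s + a) / xiFun (s - a)‖ := by
      rw [norm_div, one_le_div₀ (norm_pos_iff.mpr hne)]
      exact h1
    nlinarith)
  simpa using h

lemma differentiableAt_logDeriv_xiFun (hRH : RiemannHypothesis) {s : ℂ} (hs : 1 / 2 < s.re) :
    DifferentiableAt ℂ (logDeriv xiFun) s := by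
  have h := differentiable_xiFun
  have : Differentiable ℂ (deriv xiFun) := by
    have := (h.differentiableOn (s := univ)).deriv isOpen_univ
    rwa [differentiableOn_univ] at this
  exact (this s).div (h s) (xiFun_ne_zero hRH hs)

lemma norm_logDeriv_xiFun_sub_le (hRH : RiemannHypothesis) {s : ℂ} (hs : 1 / 2 < s.re) :
    ‖logDeriv xiFun s - logDeriv xiFun 1‖ ≤
      0.07 * ‖s - 1‖ * (‖s‖ + ‖s - 1‖) / (s.re - 1 / 2) := by
  have hs0 : s ≠ 0 := by rintro rfl; norm_num at hs
  have hre : ∀ w ∈ Metric.ball (0 : ℂ) 1, 1 / 2 < ((1 - w)⁻¹).re := by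
    intro w hw
    have hw : ‖w‖ < 1 := by simpa using hw
    have h1 : 1 - w ≠ 0 := fun h => by
      rw [← sub_eq_zero.mp h] at hw
      simp at hw
    rw [inv_re, lt_div_iff₀ (normSq_pos.mpr h1)]
    have h2 : normSq w < 1 := by
      rw [normSq_eq_norm_sq]
      nlinarith [norm_nonneg w]
    rw [normSq_apply] at h2 ⊢
    simp only [sub_re, sub_im, one_re, one_im]
    nlinarith
  have hsq : ‖s‖ ^ 2 - ‖s - 1‖ ^ 2 = 2 * s.re - 1 := by
    rw [Complex.sq_norm, Complex.sq_norm, normSq_apply, normSq_apply]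
    simp
    ring
  have hlt : ‖s - 1‖ < ‖s‖ := by
    refine lt_of_pow_lt_pow_left₀ 2 (norm_nonneg _) ?_
    linarith
  have hsp : 0 < ‖s‖ := norm_pos_iff.mpr hs0
  have hwn : ‖(s - 1) / s‖ < 1 := by rwa [norm_div, div_lt_one hsp]
  have e : (1 - (s - 1) / s)⁻¹ = s := by
    field_simp
    ring
  have h := borelCaratheodory_zero (M := 0.07) (R := 1) (z := (s - 1) / s)
    (f := fun w => logDeriv xiFun 1 - logDeriv xiFun ((1 - w)⁻¹)) (by norm_num)
    (fun w hw => by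
      refine DifferentiableAt.differentiableWithinAt (DifferentiableAt.const_sub ?_ _)
      refine (differentiableAt_logDeriv_xiFun hRH (hre w hw)).comp w
        (f := fun w : ℂ => (1 - w)⁻¹) (DifferentiableAt.inv (by fun_prop) fun h0 => ?_)
      have := hre w hw
      rw [h0] at this
      norm_num at this)
    (fun w hw => by
      show (logDeriv xiFun 1 - logDeriv xiFun ((1 - w)⁻¹)).re ≤ 0.07
      have h1 := re_logDeriv_xiFun_nonneg hRH (hre w hw)
      have h2 := log_four_mul_pi_ge
      have h3 := Real.eulerMascheroniConstant_lt_two_thirds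
      rw [sub_re, logDeriv_xiFun_one, ofReal_re]
      norm_num at h1 h2 h3 ⊢
      linarith)
    one_pos (by simpa using hwn) (by simp)
  simp only [e] at h
  rw [norm_sub_rev]
  refine h.trans (le_of_eq ?_)
  have h4 : ‖s‖ - ‖s - 1‖ ≠ 0 := by linarith
  have h5 : s.re - 1 / 2 = (‖s‖ - ‖s - 1‖) * (‖s‖ + ‖s - 1‖) / 2 := by
    linarith
  have h6 : ‖s‖ + ‖s - 1‖ ≠ 0 := by positivity
  rw [h5, norm_div]
  field_simp

/-- The analytic continuation of `s ↦ L(Λ, s) - 1 / (s - 1)` to a neighbourhood of `re s = 1`. -/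
noncomputable def zetaLogDerivRem (s : ℂ) : ℂ :=
  digamma (s / 2 + 1) / 2 - Complex.log Real.pi / 2 - logDeriv xiFun s

lemma differentiableAt_digamma {s : ℂ} (hs : 0 < s.re) : DifferentiableAt ℂ digamma s := by
  have hopen : IsOpen {s : ℂ | 0 < s.re} := isOpen_lt continuous_const continuous_re
  have hd : DifferentiableOn ℂ Gamma {s : ℂ | 0 < s.re} := fun w hw =>
    (differentiableAt_Gamma _ fun m hm => by
      have hw : 0 < w.re := hw
      have := congrArg re hm
      simp at this
      linarith [(m.cast_nonneg : (0 : ℝ) ≤ m)]).differentiableWithinAt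
  have hmem := hopen.mem_nhds hs
  exact ((hd.deriv hopen).differentiableAt hmem).div (hd.differentiableAt hmem)
    (Gamma_ne_zero_of_re_pos hs)

lemma differentiableAt_zetaLogDerivRem (hRH : RiemannHypothesis) {s : ℂ} (hs : 1 / 2 < s.re) :
    DifferentiableAt ℂ zetaLogDerivRem s := by
  have h1 : DifferentiableAt ℂ (fun s : ℂ => digamma (s / 2 + 1)) s :=
    (differentiableAt_digamma (by
      simp only [add_re, one_re, div_ofNat_re]; linarith)).comp s
      (f := fun s : ℂ => s / 2 + 1) (by fun_prop)
  exact ((h1.div_const 2).sub_const _).sub (differentiableAt_logDeriv_xiFun hRH hs)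

lemma zetaLogDerivRem_one : zetaLogDerivRem 1 = ((-Real.eulerMascheroniConstant : ℝ) : ℂ) := by
  have h1 : digamma (1 / 2 + 1) = - 2 * Complex.log 2 - Real.eulerMascheroniConstant + 2 := by
    rw [digamma_apply_add_one, digamma_one_half]
    · norm_num
    · intro m hm
      have := congrArg re hm
      simp at this
      linarith [(m.cast_nonneg : (0 : ℝ) ≤ m)]
  have h2 : (Real.log (4 * Real.pi) : ℂ) = 2 * Complex.log 2 + Complex.log Real.pi := by
    rw [Real.log_mul (by norm_num) Real.pi_ne_zero, show (4 : ℝ) = 2 ^ 2 by norm_num, Real.log_pow,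
      ← ofReal_log Real.pi_pos.le]
    push_cast
    rw [ofReal_log (by norm_num)]
    norm_num
  rw [zetaLogDerivRem, h1, logDeriv_xiFun_one]
  push_cast
  rw [h2]
  ring

lemma norm_zetaLogDerivRem_sub_le (hRH : RiemannHypothesis) {s : ℂ} (hs : 3 / 4 ≤ s.re) :
    ‖zetaLogDerivRem s - zetaLogDerivRem 1‖ ≤
      ‖s - 1‖ * (2 / 3 + 0.28 * (‖s‖ + ‖s - 1‖)) := by
  have h1 := norm_digamma_sub_le (u := s / 2 + 1) (v := 1 / 2 + 1) (m := 11 / 8) (by norm_num)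
    (by simp only [add_re, one_re, div_ofNat_re]; linarith) (by norm_num)
  have h2 := norm_logDeriv_xiFun_sub_le hRH (by linarith : 1 / 2 < s.re)
  have h3 : 0.07 * ‖s - 1‖ * (‖s‖ + ‖s - 1‖) / (s.re - 1 / 2) ≤
      0.07 * ‖s - 1‖ * (‖s‖ + ‖s - 1‖) / (1 / 4) := by
    gcongr
    linarith
  have e : s / 2 + 1 - (1 / 2 + 1) = (s - 1) / 2 := by ring
  have e2 : ‖(s - 1) / 2‖ = ‖s - 1‖ / 2 := by simp
  rw [e, e2] at h1
  have e3 : zetaLogDerivRem s - zetaLogDerivRem 1 = (digamma (s / 2 + 1) - digamma (1 / 2 + 1)) / 2 -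
      (logDeriv xiFun s - logDeriv xiFun 1) := by
    simp only [zetaLogDerivRem]
    ring
  rw [e3]
  refine (norm_sub_le _ _).trans ?_
  rw [norm_div, Complex.norm_ofNat]
  norm_num at h1 h2 h3 ⊢
  linarith

lemma LSeries_vonMangoldt_eq_zetaLogDerivRem_add {s : ℂ} (hs : 1 < s.re) :
    LSeries (fun n => (ArithmeticFunction.vonMangoldt n : ℂ)) s =
      zetaLogDerivRem s + 1 / (s - 1) := by
  have hs1 : s ≠ 1 := by rintro rfl; norm_num at hs
  have hs1' : s - 1 ≠ 0 := sub_ne_zero.mpr hs1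
  have h0 : 0 < s.re := by linarith
  rw [ArithmeticFunction.LSeries_vonMangoldt_eq_deriv_riemannZeta_div hs]
  have hG0 : 0 < (s / 2 + 1).re := by simp only [add_re, one_re, div_ofNat_re]; linarith
  have hG : DifferentiableAt ℂ Gamma (s / 2 + 1) := by
    refine differentiableAt_Gamma _ fun m hm => ?_
    rw [hm] at hG0
    simp at hG0
    linarith [(m.cast_nonneg : (0 : ℝ) ≤ m)]
  have hpi : (Real.pi : ℂ) ≠ 0 := by exact_mod_cast Real.pi_ne_zero
  have d1 := (hasDerivAt_id s).sub_const 1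
  have d2 := (differentiableAt_riemannZeta hs1).hasDerivAt
  have d3 := ((hasDerivAt_id s).neg.div_const 2).const_cpow (c := (Real.pi : ℂ)) (Or.inl hpi)
  have d4 : HasDerivAt (fun s : ℂ => Gamma (s / 2 + 1)) (deriv Gamma (s / 2 + 1) * (1 / 2)) s :=
    hG.hasDerivAt.comp s (((hasDerivAt_id s).div_const 2).add_const 1)
  have d := (d1.mul d2).mul ((d3.const_mul 2).mul d4)
  have hx : xiFun =ᶠ[𝓝 s] fun s : ℂ => (s - 1) * riemannZeta s *
      (2 * (Real.pi : ℂ) ^ (-s / 2) * Gamma (s / 2 + 1)) := by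
    filter_upwards [(isOpen_lt continuous_const continuous_re).mem_nhds hs] with w hw
    have hw : 1 < w.re := hw
    exact xiFun_eq (by linarith) (by rintro rfl; norm_num at hw)
  have hder := (d.congr_of_eventuallyEq hx).deriv
  have hz : riemannZeta s ≠ 0 := riemannZeta_ne_zero_of_one_lt_re hs
  have hGn : Gamma (s / 2 + 1) ≠ 0 := Gamma_ne_zero_of_re_pos hG0
  have hpn : (Real.pi : ℂ) ^ (-s / 2) ≠ 0 := by simp [cpow_eq_zero_iff, Real.pi_ne_zero]
  rw [zetaLogDerivRem, logDeriv_apply, hder, xiFun_eq h0 hs1, digamma, logDeriv_apply]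
  simp only [id, Pi.mul_apply, Pi.neg_apply]
  generalize Gamma (s / 2 + 1) = g at hGn ⊢
  generalize (Real.pi : ℂ) ^ (-s / 2) = p at hpn ⊢
  generalize deriv Gamma (s / 2 + 1) = g'
  field_simp
  ring

lemma norm_Gamma_le_Gamma_re {s : ℂ} (hs : 0 < s.re) : ‖Gamma s‖ ≤ Real.Gamma s.re := by
  rw [Gamma_eq_integral hs, Real.Gamma_eq_integral hs, GammaIntegral]
  refine norm_integral_le_of_norm_le (Real.GammaIntegral_convergent hs) ?_
  filter_upwards [ae_restrict_mem measurableSet_Ioi] with x hx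
  have hx : 0 < x := hx
  rw [norm_mul, norm_real, Real.norm_of_nonneg (Real.exp_pos _).le,
    norm_cpow_eq_rpow_re_of_pos hx]
  simp

lemma Gamma_add_five {w : ℂ} (hw : 0 ≤ w.re) :
    Gamma (w + 5) = (w + 4) * (w + 3) * (w + 2) * (w + 1) * Gamma (w + 1) := by
  have h : ∀ k : ℝ, 0 < k → w + k ≠ 0 := fun k hk h0 => by
    have := congrArg re h0
    simp at this
    linarith
  have h1 := h 1 (by norm_num)
  have h2 := h 2 (by norm_num)
  have h3 := h 3 (by norm_num)
  have h4 := h 4 (by norm_num)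
  push_cast at h1 h2 h3 h4
  rw [show w + 5 = w + 4 + 1 by ring, Gamma_add_one _ h4, show w + 4 = w + 3 + 1 by ring,
    Gamma_add_one _ (by simpa using h3), show w + 3 = w + 2 + 1 by ring,
    Gamma_add_one _ (by simpa using h2), show w + 2 = w + 1 + 1 by ring, Gamma_add_one _ h1]
  ring

lemma norm_Gamma_add_one_le {w : ℂ} (hw : 0 ≤ w.re) :
    ‖Gamma (w + 1)‖ ≤ Real.Gamma (w.re + 5) / (1 + w.im ^ 2) ^ 2 := by
  have h := norm_Gamma_le_Gamma_re (s := w + 5) (by simp; linarith)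
  have h1 : ∀ k : ℝ, 1 ≤ k → √(1 + w.im ^ 2) ≤ ‖w + k‖ := by
    intro k hk
    refine Real.sqrt_le_iff.mpr ⟨norm_nonneg _, ?_⟩
    rw [Complex.sq_norm, normSq_apply]
    simp
    nlinarith
  have e1 := h1 1 (by norm_num)
  have e2 := h1 2 (by norm_num)
  have e3 := h1 3 (by norm_num)
  have e4 := h1 4 (by norm_num)
  push_cast at e1 e2 e3 e4
  rw [Gamma_add_five hw] at h
  simp only [norm_mul, add_re, re_ofNat] at h
  rw [le_div_iff₀ (by positivity), mul_comm]
  refine le_trans ?_ h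
  gcongr
  calc (1 + w.im ^ 2) ^ 2 = √(1 + w.im ^ 2) * √(1 + w.im ^ 2) * √(1 + w.im ^ 2) *
        √(1 + w.im ^ 2) := by
        rw [mul_assoc, Real.mul_self_sqrt (by positivity)]
        ring
    _ ≤ _ := by gcongr

lemma Gamma_one_add_le_one {c : ℝ} (h0 : 0 ≤ c) (h1 : c ≤ 1) : Real.Gamma (1 + c) ≤ 1 := by
  have hc := Real.convexOn_Gamma.2
  have h := @hc 1 (by simp) 2 (by simp) (1 - c) c (by linarith) h0 (by ring)
  simp only [smul_eq_mul, Real.Gamma_one, Real.Gamma_two] at h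
  ring_nf at h ⊢
  exact h

lemma norm_Gamma_one_add_le {c t : ℝ} (h0 : 0 < c) (h1 : c ≤ 1 / 4) :
    ‖Gamma (1 + (c + t * I))‖ ≤ 1 / (1 + 0.16 * t ^ 2) ^ 2 := by
  set w : ℂ := c + t * I with hw
  have hre : w.re = c := by simp [hw]
  have him : w.im = t := by simp [hw]
  have h := norm_Gamma_le_Gamma_re (s := w + 5) (by simp; linarith)
  rw [Gamma_add_five (by linarith)] at h
  simp only [norm_mul, add_re, re_ofNat, hre] at h
  have hG : Real.Gamma (c + 5) = (c + 4) * (c + 3) * (c + 2) * (c + 1) * Real.Gamma (1 + c) := by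
    rw [show c + 5 = c + 4 + 1 by ring, Real.Gamma_add_one (by linarith),
      show c + 4 = c + 3 + 1 by ring, Real.Gamma_add_one (by linarith),
      show c + 3 = c + 2 + 1 by ring, Real.Gamma_add_one (by linarith),
      show c + 2 = c + 1 + 1 by ring, Real.Gamma_add_one (by linarith), add_comm 1 c]
    ring
  have hk : ∀ k r : ℝ, 1 ≤ k → 0 ≤ r → r * (k + 1 / 4) ^ 2 ≤ 1 →
      (c + k) ^ 2 * (1 + r * t ^ 2) ≤ ‖w + k‖ ^ 2 := by
    intro k r hk hr hkr
    rw [Complex.sq_norm, normSq_apply]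
    simp only [add_re, add_im, hre, him, ofReal_re, ofReal_im]
    have : r * (c + k) ^ 2 ≤ 1 := by
      refine le_trans ?_ hkr
      gcongr r * ?_ ^ 2
      linarith
    nlinarith [mul_le_mul_of_nonneg_right this (sq_nonneg t)]
  have e1 := hk 1 0.64 (by norm_num) (by norm_num) (by norm_num)
  have e2 := hk 2 0.1975 (by norm_num) (by norm_num) (by norm_num)
  have e3 := hk 3 0.0946 (by norm_num) (by norm_num) (by norm_num)
  have e4 := hk 4 0.0553 (by norm_num) (by norm_num) (by norm_num)
  push_cast at e1 e2 e3 e4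
  set P : ℝ := (c + 4) * (c + 3) * (c + 2) * (c + 1) with hP
  have hP0 : 0 < P := by positivity
  have hprod : (P * (1 + 0.16 * t ^ 2) ^ 2) ^ 2 ≤
      (‖w + 4‖ * ‖w + 3‖ * ‖w + 2‖ * ‖w + 1‖) ^ 2 := by
    calc (P * (1 + 0.16 * t ^ 2) ^ 2) ^ 2 = P ^ 2 * (1 + 0.16 * t ^ 2) ^ 4 := by ring
      _ ≤ P ^ 2 * ((1 + 0.0553 * t ^ 2) * (1 + 0.0946 * t ^ 2) * (1 + 0.1975 * t ^ 2) *
          (1 + 0.64 * t ^ 2)) := by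
        gcongr
        have : 0 ≤ t ^ 2 := sq_nonneg t
        generalize t ^ 2 = u at this
        nlinarith [pow_nonneg this 2, pow_nonneg this 3, pow_nonneg this 4]
      _ = ((c + 4) ^ 2 * (1 + 0.0553 * t ^ 2)) * ((c + 3) ^ 2 * (1 + 0.0946 * t ^ 2)) *
          ((c + 2) ^ 2 * (1 + 0.1975 * t ^ 2)) * ((c + 1) ^ 2 * (1 + 0.64 * t ^ 2)) := by
        rw [hP]; ring
      _ ≤ ‖w + 4‖ ^ 2 * ‖w + 3‖ ^ 2 * ‖w + 2‖ ^ 2 * ‖w + 1‖ ^ 2 := by gcongr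
      _ = _ := by ring
  have hprod2 := abs_le_of_sq_le_sq' hprod (by positivity) |>.2
  rw [add_comm 1 w, le_div_iff₀ (by positivity)]
  have h5 : ‖Gamma (w + 1)‖ * (P * (1 + 0.16 * t ^ 2) ^ 2) ≤ P * 1 := by
    calc _ ≤ ‖Gamma (w + 1)‖ * (‖w + 4‖ * ‖w + 3‖ * ‖w + 2‖ * ‖w + 1‖) := by gcongr
      _ ≤ Real.Gamma (c + 5) := by rw [mul_comm]; exact h
      _ = P * Real.Gamma (1 + c) := hG
      _ ≤ P * 1 := by
        gcongr
        exact Gamma_one_add_le_one h0.le (by linarith)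
  rw [mul_left_comm] at h5
  exact le_of_mul_le_mul_left h5 hP0

lemma integrable_Gamma_one_add : Integrable fun y : ℝ => Gamma (1 + y * I) := by
  have hre (y : ℝ) : (1 + y * I : ℂ).re = 1 := by simp
  have hc : Continuous fun y : ℝ => Gamma (1 + y * I) := by
    refine continuous_iff_continuousAt.2 fun y => ?_
    refine ContinuousAt.comp (f := fun y : ℝ => (1 + y * I : ℂ)) (g := Gamma) ?_ (by fun_prop)
    refine (differentiableAt_Gamma _ fun m h => ?_).continuousAt
    have := congrArg re h
    rw [hre] at this
    simp only [neg_re, natCast_re] at this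
    linarith [(Nat.cast_nonneg m : (0 : ℝ) ≤ m)]
  refine (integrable_inv_one_add_sq.const_mul (Real.Gamma 5)).mono' hc.aestronglyMeasurable ?_
  refine Eventually.of_forall fun y => ?_
  have h := norm_Gamma_add_one_le (w := y * I) (by simp)
  rw [add_comm]
  refine h.trans ?_
  simp only [mul_re, ofReal_re, I_re, ofReal_im, I_im, mul_im, mul_zero, mul_one, sub_self, zero_add,
    add_zero]
  rw [div_eq_mul_inv]
  have hG : 0 < Real.Gamma 5 := Real.Gamma_pos_of_pos (by norm_num)
  refine mul_le_mul_of_nonneg_left ?_ hG.le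
  refine inv_anti₀ (by positivity) ?_
  nlinarith [sq_nonneg y]

lemma exp_neg_eq_integral_Gamma {x : ℝ} (hx : 0 < x) :
    ((Real.exp (-x) : ℝ) : ℂ) =
      (1 / (2 * Real.pi)) * ∫ y : ℝ, Gamma (1 + y * I) * (x : ℂ) ^ (-(1 + y * I)) := by
  have hG (y : ℝ) : mellin (fun x : ℝ => ((Real.exp (-x) : ℝ) : ℂ)) (1 + y * I) =
      Gamma (1 + y * I) := by
    rw [Gamma_eq_integral (by simp), GammaIntegral_eq_mellin]
  have h := mellinInv_mellin_eq 1 (fun x : ℝ => ((Real.exp (-x) : ℝ) : ℂ)) hx ?_ ?_ ?_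
  · rw [← h]
    simp only [mellinInv, ofReal_one, hG, smul_eq_mul, real_smul]
    push_cast
    congr 1
    exact integral_congr_ae (Eventually.of_forall fun y => mul_comm _ _)
  · have := GammaIntegral_convergent (s := 1) (by simp)
    refine this.congr ?_
    filter_upwards with x
    simp [mul_comm]
  · have := integrable_Gamma_one_add
    simpa only [VerticalIntegrable, ofReal_one, hG] using this
  · fun_prop

lemma integral_mul_exp_eq_integral_Gamma {α : Type*} [MeasurableSpace α] {ν : Measure α}
    [SFinite ν] {a p : α → ℝ} (ha : Measurable a) (hp : Measurable p)
    (hap : ∀ᵐ t ∂ν, a t ≠ 0 → 0 < p t) (hint : Integrable (fun t => a t / p t) ν)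
    {δ : ℝ} (hδ : 0 < δ) :
    Integrable (fun y : ℝ => Gamma (1 + y * I) * (δ : ℂ) ^ (-(1 + y * I)) *
        ∫ t, (a t : ℂ) * (p t : ℂ) ^ (-(1 + y * I)) ∂ν) ∧
    ((∫ t, a t * Real.exp (-(δ * p t)) ∂ν : ℝ) : ℂ) =
      (1 / (2 * Real.pi)) * ∫ y : ℝ, Gamma (1 + y * I) * (δ : ℂ) ^ (-(1 + y * I)) *
        ∫ t, (a t : ℂ) * (p t : ℂ) ^ (-(1 + y * I)) ∂ν := by
  set f : α → ℝ → ℂ := fun t y => Gamma (1 + y * I) * (δ : ℂ) ^ (-(1 + y * I)) *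
    ((a t : ℂ) * (p t : ℂ) ^ (-(1 + y * I))) with hf
  have hpow {x : ℝ} (hx : 0 < x) (y : ℝ) : ‖(x : ℂ) ^ (-(1 + y * I))‖ = x⁻¹ := by
    rw [norm_cpow_eq_rpow_re_of_pos hx]
    simp [Real.rpow_neg_one]
  have hfint : Integrable (Function.uncurry f) (ν.prod volume) := by
    have h1 := (hint.norm.mul_prod integrable_Gamma_one_add.norm).const_mul δ⁻¹
    have hm1 : AEStronglyMeasurable (fun z : α × ℝ => Gamma (1 + z.2 * I)) (ν.prod volume) :=
      integrable_Gamma_one_add.aestronglyMeasurable.comp_snd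
    have hm2 : Measurable fun z : α × ℝ => (δ : ℂ) ^ (-(1 + z.2 * I)) *
        ((a z.1 : ℂ) * (p z.1 : ℂ) ^ (-(1 + z.2 * I))) := by
      fun_prop
    have hm : AEStronglyMeasurable (Function.uncurry f) (ν.prod volume) := by
      refine (hm1.mul hm2.aestronglyMeasurable).congr (Eventually.of_forall fun z => ?_)
      simp only [hf, Function.uncurry, Pi.mul_apply]
      ring
    refine h1.mono' hm ?_
    have hap' : ∀ᵐ z : α × ℝ ∂(ν.prod volume), a z.1 ≠ 0 → 0 < p z.1 :=
      Measure.quasiMeasurePreserving_fst.ae hap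
    filter_upwards [hap'] with z hz
    simp only [hf, Function.uncurry, norm_mul, hpow hδ]
    by_cases h0 : a z.1 = 0
    · simp [h0]
    · rw [hpow (hz h0), norm_div, norm_real, Real.norm_of_nonneg (hz h0).le]
      refine le_of_eq ?_
      ring
  have hy (y : ℝ) : ∫ t, f t y ∂ν = Gamma (1 + y * I) * (δ : ℂ) ^ (-(1 + y * I)) *
        ∫ t, (a t : ℂ) * (p t : ℂ) ^ (-(1 + y * I)) ∂ν := integral_const_mul _ _
  refine ⟨by simpa only [Function.uncurry, hy] using hfint.integral_prod_right, ?_⟩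
  rw [← integral_complex_ofReal, ← integral_congr_ae (Eventually.of_forall hy),
    ← integral_integral_swap hfint, ← integral_const_mul]
  refine integral_congr_ae ?_
  filter_upwards [hap] with t ht
  by_cases h0 : a t = 0
  · simp [h0, hf]
  · have hpt := ht h0
    rw [ofReal_mul, exp_neg_eq_integral_Gamma (mul_pos hδ hpt)]
    rw [← mul_assoc, mul_comm (a t : ℂ), mul_assoc, ← integral_const_mul]
    congr 1
    refine integral_congr_ae (Eventually.of_forall fun y => ?_)
    simp only [hf]
    rw [ofReal_mul, mul_cpow_ofReal_nonneg hδ.le hpt.le]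
    ring

lemma exp_neg_le_inv {x : ℝ} (hx : 0 < x) : Real.exp (-x) ≤ x⁻¹ := by
  rw [Real.exp_neg]
  exact inv_anti₀ hx (by linarith [Real.add_one_le_exp x])

lemma tsum_vonMangoldt_eq_integral_Gamma {σ δ : ℝ} (hσ : 0 < σ) (hδ : 0 < δ) :
    Integrable (fun y : ℝ => Gamma (1 + y * I) * (δ : ℂ) ^ (-(1 + y * I)) *
        LSeries (fun n => (ArithmeticFunction.vonMangoldt n : ℂ)) (σ + (1 + y * I))) ∧
    ((∑' n : ℕ, ArithmeticFunction.vonMangoldt n * (n : ℝ) ^ (-σ) * Real.exp (-(δ * n)) : ℝ) : ℂ) =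
      (1 / (2 * Real.pi)) * ∫ y : ℝ, Gamma (1 + y * I) * (δ : ℂ) ^ (-(1 + y * I)) *
        LSeries (fun n => (ArithmeticFunction.vonMangoldt n : ℂ)) (σ + (1 + y * I)) := by
  set a : ℕ → ℝ := fun n => ArithmeticFunction.vonMangoldt n * (n : ℝ) ^ (-σ) with ha
  have ha0 (n : ℕ) (hn : a n ≠ 0) : 0 < (n : ℝ) := by
    rcases Nat.eq_zero_or_pos n with rfl | h
    · simp [ha] at hn
    · exact_mod_cast h
  have hterm (y : ℝ) (n : ℕ) : (a n : ℂ) * ((n : ℝ) : ℂ) ^ (-(1 + y * I)) =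
      LSeries.term (fun n => (ArithmeticFunction.vonMangoldt n : ℂ)) (σ + (1 + y * I)) n := by
    rcases Nat.eq_zero_or_pos n with rfl | h
    · simp [ha]
    · have hn : (n : ℂ) ≠ 0 := by exact_mod_cast h.ne'
      rw [LSeries.term_of_ne_zero h.ne', div_eq_mul_inv, ← cpow_neg,
        neg_add (σ : ℂ), cpow_add _ _ hn]
      simp only [ha]
      push_cast [ofReal_cpow (Nat.cast_nonneg n)]
      ring
  have hsum (y : ℝ) : Summable fun n => (a n : ℂ) * ((n : ℝ) : ℂ) ^ (-(1 + y * I)) := by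
    simp only [hterm]
    exact ArithmeticFunction.LSeriesSummable_vonMangoldt (by simpa using hσ)
  have hint : Integrable (fun n : ℕ => a n / (n : ℝ)) Measure.count := by
    rw [integrable_count_iff]
    refine (hsum 0).norm.congr fun n => ?_
    rcases Nat.eq_zero_or_pos n with rfl | h
    · simp [ha]
    · simp [cpow_neg_one, div_eq_mul_inv]
  have hinner (y : ℝ) : ∫ n : ℕ, (a n : ℂ) * ((n : ℝ) : ℂ) ^ (-(1 + y * I)) ∂Measure.count =
      LSeries (fun n => (ArithmeticFunction.vonMangoldt n : ℂ)) (σ + (1 + y * I)) := by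
    rw [integral_countable (integrable_count_iff.2 (hsum y).norm), LSeries]
    simp only [count_real_singleton, one_smul, hterm]
  have houter : ∫ n : ℕ, a n * Real.exp (-(δ * n)) ∂Measure.count =
      ∑' n : ℕ, a n * Real.exp (-(δ * n)) := by
    rw [integral_countable]
    · simp only [count_real_singleton, one_smul]
    · refine (hint.norm.const_mul δ⁻¹).mono' (by fun_prop) (Eventually.of_forall fun n => ?_)
      by_cases h0 : a n = 0
      · simp [h0]
      · have hn := ha0 n h0
        rw [norm_mul, norm_div, Real.norm_of_nonneg hn.le, Real.norm_of_nonneg (Real.exp_pos _).le]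
        refine (mul_le_mul_of_nonneg_left (exp_neg_le_inv (mul_pos hδ hn)) (norm_nonneg _)).trans_eq ?_
        rw [mul_inv]
        ring
  have h := integral_mul_exp_eq_integral_Gamma (ν := Measure.count) (a := a)
    (p := fun n : ℕ => (n : ℝ)) (measurable_of_countable _) (measurable_of_countable _)
    (Eventually.of_forall ha0) hint hδ
  simpa only [hinner, houter] using h

lemma setIntegral_rpow_mul_exp_eq_integral_Gamma {σ δ : ℝ} (hσ : 0 < σ) (hδ : 0 < δ) :
    Integrable (fun y : ℝ => Gamma (1 + y * I) * (δ : ℂ) ^ (-(1 + y * I)) *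
        (1 / (σ + (1 + y * I) - 1))) ∧
    ((∫ t in Ioi (1 : ℝ), t ^ (-σ) * Real.exp (-(δ * t)) : ℝ) : ℂ) =
      (1 / (2 * Real.pi)) * ∫ y : ℝ, Gamma (1 + y * I) * (δ : ℂ) ^ (-(1 + y * I)) *
        (1 / (σ + (1 + y * I) - 1)) := by
  have hinner (y : ℝ) : ∫ t in Ioi (1 : ℝ), ((t ^ (-σ) : ℝ) : ℂ) * (t : ℂ) ^ (-(1 + y * I)) =
      1 / (σ + (1 + y * I) - 1) := by
    have h := integral_Ioi_cpow_of_lt (a := -(σ + (1 + y * I))) (c := 1) (by simpa using hσ)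
      one_pos
    rw [ofReal_one, one_cpow] at h
    have h2 : (-1 : ℂ) / (-(σ + (1 + y * I)) + 1) = 1 / (σ + (1 + y * I) - 1) := by
      rw [← neg_div_neg_eq]
      congr 1 <;> ring
    rw [← h2, ← h]
    refine setIntegral_congr_fun measurableSet_Ioi fun t ht => ?_
    have ht : (0 : ℝ) < t := one_pos.trans ht
    rw [neg_add (σ : ℂ), cpow_add _ _ (by exact_mod_cast ht.ne'), ofReal_cpow ht.le]
    push_cast
    ring
  have hint : Integrable (fun t : ℝ => t ^ (-σ) / t) (volume.restrict (Ioi 1)) := by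
    refine (integrableOn_Ioi_rpow_of_lt (a := -σ - 1) (by linarith) one_pos).congr ?_
    filter_upwards [ae_restrict_mem measurableSet_Ioi] with t ht
    have ht : (0 : ℝ) < t := one_pos.trans ht
    rw [Real.rpow_sub ht, Real.rpow_one]
  have h := integral_mul_exp_eq_integral_Gamma (ν := volume.restrict (Ioi (1 : ℝ)))
    (a := fun t => t ^ (-σ)) (p := fun t => t) (by fun_prop) (by fun_prop) ?_ hint hδ
  · simpa only [hinner] using h
  · filter_upwards [ae_restrict_mem measurableSet_Ioi] with t ht _
    exact one_pos.trans ht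

lemma tsum_sub_setIntegral_eq_integral_Gamma {σ δ : ℝ} (hσ : 0 < σ) (hδ : 0 < δ) :
    Integrable (fun y : ℝ => Gamma (1 + y * I) * (δ : ℂ) ^ (-(1 + y * I)) *
      (zetaLogDerivRem (σ + (1 + y * I)) - zetaLogDerivRem 1)) ∧
    ((∑' n : ℕ, ArithmeticFunction.vonMangoldt n * (n : ℝ) ^ (-σ) * Real.exp (-(δ * n)) -
      (∫ t in Ioi (1 : ℝ), t ^ (-σ) * Real.exp (-(δ * t))) +
      Real.eulerMascheroniConstant * Real.exp (-δ) : ℝ) : ℂ) =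
      (1 / (2 * Real.pi)) * ∫ y : ℝ, Gamma (1 + y * I) * (δ : ℂ) ^ (-(1 + y * I)) *
        (zetaLogDerivRem (σ + (1 + y * I)) - zetaLogDerivRem 1) := by
  obtain ⟨i1, e1⟩ := tsum_vonMangoldt_eq_integral_Gamma hσ hδ
  obtain ⟨i2, e2⟩ := setIntegral_rpow_mul_exp_eq_integral_Gamma hσ hδ
  have i3 : Integrable fun y : ℝ => Gamma (1 + y * I) * (δ : ℂ) ^ (-(1 + y * I)) := by
    refine (integrable_Gamma_one_add.mul_bdd (c := δ⁻¹)
      (by fun_prop : Measurable fun y : ℝ => (δ : ℂ) ^ (-(1 + y * I))).aestronglyMeasurable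
      (Eventually.of_forall fun y => le_of_eq ?_))
    rw [norm_cpow_eq_rpow_re_of_pos hδ]
    simp [Real.rpow_neg_one]
  have e3 := exp_neg_eq_integral_Gamma hδ
  have hfun (y : ℝ) : Gamma (1 + y * I) * (δ : ℂ) ^ (-(1 + y * I)) *
      (zetaLogDerivRem (σ + (1 + y * I)) - zetaLogDerivRem 1) =
      Gamma (1 + y * I) * (δ : ℂ) ^ (-(1 + y * I)) *
        LSeries (fun n => (ArithmeticFunction.vonMangoldt n : ℂ)) (σ + (1 + y * I)) -
      Gamma (1 + y * I) * (δ : ℂ) ^ (-(1 + y * I)) * (1 / (σ + (1 + y * I) - 1)) -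
      Gamma (1 + y * I) * (δ : ℂ) ^ (-(1 + y * I)) * zetaLogDerivRem 1 := by
    rw [LSeries_vonMangoldt_eq_zetaLogDerivRem_add (by simpa using hσ)]
    ring
  simp only [hfun]
  refine ⟨(i1.sub i2).sub (i3.mul_const _), ?_⟩
  rw [integral_sub (by exact i1.sub i2) (i3.mul_const _), integral_sub i1 i2, mul_sub, mul_sub, ← e1, ← e2,
    integral_mul_const, ← mul_assoc, ← e3, zetaLogDerivRem_one]
  push_cast
  ring

lemma integral_vertical_line_eq {F : ℂ → ℂ} {a b C : ℝ} (hab : a ≤ b)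
    (hd : ∀ w : ℂ, w.re ∈ Icc a b → DifferentiableAt ℂ F w)
    (hF : ∀ x ∈ Icc a b, ∀ y : ℝ, ‖F (x + y * I)‖ ≤ C / (1 + y ^ 2)) :
    ∫ y : ℝ, F (b + y * I) = ∫ y : ℝ, F (a + y * I) := by
  have hint : ∀ x ∈ Icc a b, Integrable fun y : ℝ => F (x + y * I) := fun x hx => by
    refine (integrable_inv_one_add_sq.const_mul C).mono' ?_ (Eventually.of_forall fun y => hF x hx y)
    refine Continuous.aestronglyMeasurable (continuous_iff_continuousAt.2 fun y => ?_)
    exact ContinuousAt.comp (f := fun y : ℝ => (x + y * I : ℂ)) (g := F)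
      (hd _ (by simpa using hx)).continuousAt (by fun_prop)
  have hlim : ∀ x ∈ Icc a b, Tendsto (fun T : ℝ => ∫ y in (-T)..T, F (x + y * I)) atTop
      (𝓝 (∫ y : ℝ, F (x + y * I))) := fun x hx =>
    intervalIntegral_tendsto_integral (hint x hx) tendsto_neg_atTop_atBot tendsto_id
  have hrect (T : ℝ) : ‖(∫ y in (-T)..T, F (b + y * I)) - ∫ y in (-T)..T, F (a + y * I)‖ ≤
      2 * (C / (1 + T ^ 2) * |b - a|) := by
    have h := integral_boundary_rect_eq_zero_of_differentiableOn F (a + (-T : ℝ) * I) (b + T * I) ?_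
    · simp only [add_re, ofReal_re, mul_re, I_re, ofReal_im, I_im, mul_zero, mul_one, sub_self,
        add_zero, add_im, mul_im, zero_add, smul_eq_mul] at h
      have hside (S : ℝ) (hS : S ^ 2 = T ^ 2) :
          ‖∫ x in a..b, F (x + S * I)‖ ≤ C / (1 + T ^ 2) * |b - a| := by
        refine intervalIntegral.norm_integral_le_of_norm_le_const fun x hx => ?_
        rw [uIoc_of_le hab] at hx
        rw [← hS]
        exact hF x ⟨hx.1.le, hx.2⟩ S
      have e : ‖(∫ y in (-T)..T, F (b + y * I)) - ∫ y in (-T)..T, F (a + y * I)‖ =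
          ‖(∫ x in a..b, F (x + T * I)) - ∫ x in a..b, F (x + (-T : ℝ) * I)‖ := by
        rw [← one_mul ‖_ - ∫ y in (-T)..T, F (a + y * I)‖, ← norm_I, ← norm_mul]
        congr 1
        linear_combination h
      rw [e, two_mul]
      exact (norm_sub_le _ _).trans (add_le_add (hside T rfl) (hside (-T) (by ring)))
    · intro w hw
      rw [mem_reProdIm] at hw
      refine (hd w ?_).differentiableWithinAt
      simpa [uIcc_of_le hab] using hw.1
  have hzero : Tendsto (fun T : ℝ => 2 * (C / (1 + T ^ 2) * |b - a|)) atTop (𝓝 0) := by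
    have h1 : Tendsto (fun T : ℝ => 1 + T ^ 2) atTop atTop :=
      tendsto_atTop_add_const_left _ _ (tendsto_pow_atTop two_ne_zero)
    have h2 := ((h1.const_div_atTop C).mul_const |b - a|).const_mul 2
    simpa using h2
  have h0 := squeeze_zero_norm hrect hzero
  have h1 := (hlim b ⟨hab, le_rfl⟩).sub (hlim a ⟨le_rfl, hab⟩)
  exact sub_eq_zero.1 (tendsto_nhds_unique h1 h0)

lemma norm_Gamma_mul_zetaLogDerivRem_sub_le (hRH : RiemannHypothesis) {σ δ : ℝ}
    (hσ : σ ∈ Ioo (1 / 2 : ℝ) 1) (hδ : 0 < δ) {w : ℂ} (hw : (1 - σ) / 2 ≤ w.re) :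
    ‖Gamma w * (δ : ℂ) ^ (-w) * (zetaLogDerivRem (σ + w) - zetaLogDerivRem 1)‖ ≤
      ‖Gamma (w + 1)‖ * δ ^ (-w.re) *
        (2 / 3 + 0.28 * (‖(σ : ℂ) + w‖ + ‖(σ : ℂ) + w - 1‖)) := by
  obtain ⟨h1, h2⟩ := hσ
  have hw0 : 0 < w.re := by linarith
  have hne : w ≠ 0 := fun h => by simp [h] at hw0
  have hle : ‖(σ : ℂ) + w - 1‖ ≤ ‖w‖ := by
    refine abs_le_of_sq_le_sq' ?_ (norm_nonneg _) |>.2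
    rw [Complex.sq_norm, Complex.sq_norm, normSq_apply, normSq_apply]
    simp only [sub_re, add_re, ofReal_re, one_re, sub_im, add_im, ofReal_im, one_im]
    nlinarith
  have hG := norm_zetaLogDerivRem_sub_le hRH (s := σ + w) (by simp; linarith)
  have hpow : ‖(δ : ℂ) ^ (-w)‖ = δ ^ (-w.re) := by
    rw [norm_cpow_eq_rpow_re_of_pos hδ, neg_re]
  rw [norm_mul, norm_mul, hpow, Gamma_add_one _ hne, norm_mul]
  have hK : 0 ≤ 2 / 3 + 0.28 * (‖(σ : ℂ) + w‖ + ‖(σ : ℂ) + w - 1‖) := by positivity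
  calc _ ≤ ‖Gamma w‖ * δ ^ (-w.re) *
        (‖w‖ * (2 / 3 + 0.28 * (‖(σ : ℂ) + w‖ + ‖(σ : ℂ) + w - 1‖))) := by
        refine mul_le_mul_of_nonneg_left (hG.trans ?_) (by positivity)
        exact mul_le_mul_of_nonneg_right hle hK
    _ = _ := by ring

lemma integral_Gamma_line_one_eq (hRH : RiemannHypothesis) {σ δ : ℝ}
    (hσ : σ ∈ Ioo (1 / 2 : ℝ) 1) (hδ : 0 < δ) :
    ∫ y : ℝ, Gamma (1 + y * I) * (δ : ℂ) ^ (-(1 + y * I)) *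
        (zetaLogDerivRem (σ + (1 + y * I)) - zetaLogDerivRem 1) =
      ∫ y : ℝ, Gamma (((1 - σ) / 2 : ℝ) + y * I) * (δ : ℂ) ^ (-(((1 - σ) / 2 : ℝ) + y * I)) *
        (zetaLogDerivRem (σ + (((1 - σ) / 2 : ℝ) + y * I)) - zetaLogDerivRem 1) := by
  have hσ' := hσ
  obtain ⟨h1, h2⟩ := hσ'
  have h := integral_vertical_line_eq (a := (1 - σ) / 2) (b := 1)
    (C := Real.Gamma 6 * (1 + δ⁻¹) * 3)
    (F := fun w => Gamma w * (δ : ℂ) ^ (-w) * (zetaLogDerivRem (σ + w) - zetaLogDerivRem 1))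
    (by linarith) ?_ ?_
  · simpa only [ofReal_one] using h
  · intro w hw
    have hw0 : 0 < w.re := by linarith [hw.1]
    have hδ' : (δ : ℂ) ≠ 0 := by exact_mod_cast hδ.ne'
    have d1 : DifferentiableAt ℂ Gamma w := differentiableAt_Gamma _ fun m hm => by
      rw [hm] at hw0
      simp only [neg_re, natCast_re] at hw0
      linarith [(Nat.cast_nonneg m : (0 : ℝ) ≤ m)]
    have d2 : DifferentiableAt ℂ (fun w : ℂ => (δ : ℂ) ^ (-w)) w :=
      differentiableAt_id.neg.const_cpow (Or.inl hδ')
    have d3 : DifferentiableAt ℂ (fun w : ℂ => zetaLogDerivRem (σ + w)) w :=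
      (differentiableAt_zetaLogDerivRem hRH (s := σ + w) (by simp; linarith)).comp w
        (differentiableAt_id.const_add _)
    exact (d1.mul d2).mul (d3.sub_const _)
  · intro x hx y
    set w : ℂ := x + y * I with hw
    have hre : w.re = x := by simp [hw]
    have him : w.im = y := by simp [hw]
    have hx0 : 0 ≤ x := by linarith [hx.1]
    have hx1 : x ≤ 1 := hx.2
    refine (norm_Gamma_mul_zetaLogDerivRem_sub_le hRH hσ hδ (by rw [hre]; exact hx.1)).trans ?_
    have hb1 := norm_Gamma_add_one_le (w := w) (by rw [hre]; exact hx0)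
    rw [hre, him] at hb1
    have hb2 : Real.Gamma (x + 5) ≤ Real.Gamma 6 :=
      Real.Gamma_strictMonoOn_Ici.monotoneOn (by simp; linarith) (by simp; norm_num) (by linarith)
    have hb3 : δ ^ (-x) ≤ 1 + δ⁻¹ := by
      rcases le_total 1 δ with h | h
      · have := Real.rpow_le_one_of_one_le_of_nonpos h (by linarith : -x ≤ 0)
        linarith [inv_pos.2 hδ]
      · have := Real.rpow_le_rpow_of_exponent_ge hδ h (by linarith : -1 ≤ -x)
        rw [Real.rpow_neg_one] at this
        linarith
    have hb4 : ‖(σ : ℂ) + w‖ ≤ 2 + |y| := by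
      refine (norm_le_abs_re_add_abs_im _).trans ?_
      simp only [add_re, ofReal_re, add_im, ofReal_im, zero_add, hre, him]
      rw [abs_of_nonneg (by linarith)]
      linarith
    have hb5 : ‖(σ : ℂ) + w - 1‖ ≤ 1 + |y| := by
      refine (norm_le_abs_re_add_abs_im _).trans ?_
      simp only [sub_re, sub_im, one_re, one_im, sub_zero, add_re, ofReal_re, add_im, ofReal_im,
        zero_add, hre, him]
      have : |σ + x - 1| ≤ 1 := abs_le.2 ⟨by linarith, by linarith⟩
      linarith
    have hb6 : 2 / 3 + 0.28 * (‖(σ : ℂ) + w‖ + ‖(σ : ℂ) + w - 1‖) ≤ 3 * (1 + y ^ 2) := by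
      nlinarith [sq_nonneg (|y| - 1), sq_abs y]
    have hG6 : 0 < Real.Gamma 6 := Real.Gamma_pos_of_pos (by norm_num)
    rw [hre]
    calc _ ≤ Real.Gamma 6 / (1 + y ^ 2) ^ 2 * (1 + δ⁻¹) * (3 * (1 + y ^ 2)) := by
          gcongr
          exact hb1.trans (by gcongr)
      _ = _ := by
          field_simp

lemma norm_integral_Gamma_line_le (hRH : RiemannHypothesis) {σ δ : ℝ}
    (hσ : σ ∈ Ioo (1 / 2 : ℝ) 1) (hδ : 0 < δ) :
    ‖∫ y : ℝ, Gamma (((1 - σ) / 2 : ℝ) + y * I) * (δ : ℂ) ^ (-(((1 - σ) / 2 : ℝ) + y * I)) *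
        (zetaLogDerivRem (σ + (((1 - σ) / 2 : ℝ) + y * I)) - zetaLogDerivRem 1)‖ ≤
      2 * Real.pi * (1.75 * δ ^ (-((1 - σ) / 2))) := by
  have hσ' := hσ
  obtain ⟨h1, h2⟩ := hσ'
  set c : ℝ := (1 - σ) / 2 with hc
  set K : ℝ := δ ^ (-c) with hK
  have hK0 : 0 < K := Real.rpow_pos_of_pos hδ _
  have hpt (y : ℝ) : ‖Gamma (c + y * I) * (δ : ℂ) ^ (-(c + y * I)) *
        (zetaLogDerivRem (σ + (c + y * I)) - zetaLogDerivRem 1)‖ ≤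
        (1.4 * K) * (1 + (0.4 * y) ^ 2)⁻¹ := by
    have hb1 := norm_Gamma_one_add_le (c := c) (t := y) (by linarith) (by linarith)
    rw [add_comm (1 : ℂ)] at hb1
    have hb2 : ‖(σ : ℂ) + (c + y * I)‖ ≤ 1 + |y| := by
      refine (norm_le_abs_re_add_abs_im _).trans ?_
      simp only [add_re, ofReal_re, mul_re, I_re, mul_zero, ofReal_im, I_im, mul_one, sub_self,
        add_zero, add_im, mul_im, zero_add]
      rw [abs_of_nonneg (by linarith)]
      linarith
    have hb3 : ‖(σ : ℂ) + (c + y * I) - 1‖ ≤ 1 / 4 + |y| := by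
      refine (norm_le_abs_re_add_abs_im _).trans ?_
      simp only [sub_re, sub_im, one_re, one_im, add_re, ofReal_re, mul_re, I_re, mul_zero,
        ofReal_im, I_im, mul_one, sub_self, add_zero, add_im, mul_im, zero_add, sub_zero]
      have : |σ + c - 1| ≤ 1 / 4 := abs_le.2 ⟨by linarith, by linarith⟩
      linarith
    have hb4 : 2 / 3 + 0.28 * (‖(σ : ℂ) + (c + y * I)‖ + ‖(σ : ℂ) + (c + y * I) - 1‖) ≤
        1.4 * (1 + 0.16 * y ^ 2) := by
      nlinarith [sq_nonneg (0.4 * |y| - 1 / 2), sq_abs y]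
    refine (norm_Gamma_mul_zetaLogDerivRem_sub_le hRH hσ hδ (by simp [hc])).trans ?_
    have hre : -((c : ℂ) + y * I).re = -c := by simp
    rw [hre]
    calc _ ≤ 1 / (1 + 0.16 * y ^ 2) ^ 2 * K * (1.4 * (1 + 0.16 * y ^ 2)) := by gcongr
      _ = _ := by
          rw [show (0.4 * y) ^ 2 = 0.16 * y ^ 2 by ring]
          field_simp
  refine (norm_integral_le_of_norm_le ?_ (Eventually.of_forall hpt)).trans ?_
  · exact (integrable_inv_one_add_sq.comp_mul_left' (by norm_num : (0.4 : ℝ) ≠ 0)).const_mul _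
  · rw [integral_const_mul, Measure.integral_comp_mul_left (fun y : ℝ => (1 + y ^ 2)⁻¹),
      integral_univ_inv_one_add_sq]
    rw [abs_of_pos (by norm_num), smul_eq_mul]
    refine le_of_eq ?_
    ring

lemma setIntegral_Ioi_one_rpow_mul_exp_le {σ δ : ℝ} (hσ : σ < 1) (hδ : 0 < δ) :
    ∫ t in Ioi (1 : ℝ), t ^ (-σ) * Real.exp (-(δ * t)) ≤
      Real.Gamma (1 - σ) * δ ^ (-(1 - σ)) := by
  have h := Real.integral_rpow_mul_exp_neg_mul_Ioi (a := 1 - σ) (by linarith) hδ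
  rw [sub_sub_cancel_left, one_div, Real.inv_rpow hδ.le, ← Real.rpow_neg hδ.le, mul_comm] at h
  rw [← h]
  refine setIntegral_mono_set ?_ ?_ (Ioi_subset_Ioi zero_le_one).eventuallyLE
  · by_contra hn
    rw [integral_undef hn] at h
    have : 0 < Real.Gamma (1 - σ) * δ ^ (-(1 - σ)) :=
      mul_pos (Real.Gamma_pos_of_pos (by linarith)) (Real.rpow_pos_of_pos hδ _)
    linarith
  · filter_upwards [ae_restrict_mem measurableSet_Ioi] with t ht
    have ht : 0 < t := ht
    simp only [Pi.zero_apply]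
    positivity

lemma Gamma_one_add_le_one_sub {η : ℝ} (h0 : 0 ≤ η) (h1 : η ≤ 1 / 2) :
    Real.Gamma (1 + η) ≤ 1 - 0.2275 * η := by
  have hc := Real.convexOn_Gamma.2
  have h := @hc 1 (by simp) (3 / 2) (by simp) (1 - 2 * η) (2 * η) (by linarith) (by linarith)
    (by ring)
  have hG : Real.Gamma (3 / 2) = √Real.pi / 2 := by
    rw [show (3 / 2 : ℝ) = 1 / 2 + 1 by norm_num, Real.Gamma_add_one (by norm_num),
      Real.Gamma_one_half_eq]
    ring
  have hs : √Real.pi ≤ 1.7725 := by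
    rw [Real.sqrt_le_left (by norm_num)]
    linarith [Real.pi_lt_d4]
  simp only [smul_eq_mul, Real.Gamma_one, hG] at h
  rw [show (1 - 2 * η) * 1 + 2 * η * (3 / 2) = 1 + η by ring] at h
  nlinarith

end

theorem vonMangoldt_weighted_sum_bound (hRH : RiemannHypothesis)
    (σ δ : ℝ) (hσ : σ ∈ Set.Ioo (1/2 : ℝ) 1) (hδ : 0 < δ) :
    ∑' n : ℕ, ArithmeticFunction.vonMangoldt n * (n : ℝ) ^ (-σ) * Real.exp (-δ * n) ≤
      δ ^ (σ - 1) / (1 - σ) + 0.07 / (2 * σ - 1) + 4 := by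
  obtain ⟨h1, h2⟩ := hσ
  have hid := (tsum_sub_setIntegral_eq_integral_Gamma (σ := σ) (by linarith) hδ).2
  rw [integral_Gamma_line_one_eq hRH ⟨h1, h2⟩ hδ] at hid
  have hnorm := norm_integral_Gamma_line_le hRH ⟨h1, h2⟩ hδ
  have hb := congrArg norm hid
  rw [norm_mul, Complex.norm_real] at hb
  have hpi : ‖(1 / (2 * Real.pi) : ℂ)‖ = (2 * Real.pi)⁻¹ := by
    rw [one_div, norm_inv, norm_mul, Complex.norm_real, Real.norm_of_nonneg Real.pi_pos.le]
    simp
  set y : ℝ := δ ^ (-((1 - σ) / 2)) with hy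
  have hle := mul_le_mul_of_nonneg_left hnorm (by positivity : 0 ≤ (2 * Real.pi)⁻¹)
  rw [inv_mul_cancel_left₀ (by positivity), ← hpi, ← hb] at hle
  have hS := (le_abs_self _).trans hle
  have hγ : 0 ≤ Real.eulerMascheroniConstant * Real.exp (-δ) :=
    mul_nonneg (by linarith [Real.one_half_lt_eulerMascheroniConstant]) (Real.exp_pos _).le
  have hI := setIntegral_Ioi_one_rpow_mul_exp_le h2 hδ
  have hy2 : δ ^ (-(1 - σ)) = y ^ 2 := by
    rw [hy, ← Real.rpow_natCast, ← Real.rpow_mul hδ.le]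
    congr 1
    push_cast
    ring
  have hG := Gamma_one_add_le_one_sub (η := 1 - σ) (by linarith) (by linarith)
  rw [add_comm, Real.Gamma_add_one (by linarith)] at hG
  have hη : 0 < 1 - σ := by linarith
  have hG' : Real.Gamma (1 - σ) ≤ 1 / (1 - σ) - 0.2275 := by
    rw [← mul_le_mul_iff_right₀ hη, mul_sub, mul_one_div_cancel hη.ne']
    linarith
  have hI' := hI.trans (mul_le_mul_of_nonneg_right hG' (Real.rpow_nonneg hδ.le _))
  have h7 : 0 ≤ 0.07 / (2 * σ - 1) := div_nonneg (by norm_num) (by linarith)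
  rw [hy2] at hI'
  simp only [neg_mul]
  rw [← neg_sub 1 σ, hy2, ← one_div_mul_eq_div]
  nlinarith [sq_nonneg (y - 3.9)]
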